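/- Assume a ≥ 2 and b ≥ 2, and set d = ab. The Foulkes–Howe map α is not surjective in degree b−1: there exists a homogeneous polynomial Q ∈ R of degree a(b−1) that is not of the form α(P) for any homogeneous P ∈ S of degree b−1. Moreover, the codimension of the image of the degree-(b−1) component of S in the space of homogeneous polynomials of degree a(b−1) in R equals C(d−a+b, b) − C(d+b−1, b−1), and in particular C(ab−a+b, b) > C(ab+b−1, b−1). (Established in the proof of Proposition 4.4, where this quantity is the last Betti number β_d of X.) -/

import Mathlib

open MvPolynomial

/-- The generic binary form `G = ∑_{i=0}^{b} u_i x^i y^{b-i}` of degree `b`,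
viewed as a polynomial in two variables `x = X 0`, `y = X 1` with coefficients in
`R = MvPolynomial (Fin (b+1)) ℂ`. -/
noncomputable def genForm (b : ℕ) : MvPolynomial (Fin 2) (MvPolynomial (Fin (b + 1)) ℂ) :=
  ∑ i : Fin (b + 1),
    MvPolynomial.C (MvPolynomial.X i) *
      MvPolynomial.X (0 : Fin 2) ^ (i : ℕ) * MvPolynomial.X (1 : Fin 2) ^ (b - (i : ℕ))

/-- The coefficient `c_j ∈ R` of `x^j y^{ab-j}` in `G^a`. -/
noncomputable def coeffC (a b j : ℕ) : MvPolynomial (Fin (b + 1)) ℂ :=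
  MvPolynomial.coeff
    (Finsupp.single (0 : Fin 2) j + Finsupp.single (1 : Fin 2) (a * b - j))
    (genForm b ^ a)

/-- The Foulkes–Howe homomorphism `α : S → R`, `z_j ↦ c_j`. -/
noncomputable def FH (a b : ℕ) :
    MvPolynomial (Fin (a * b + 1)) ℂ →ₐ[ℂ] MvPolynomial (Fin (b + 1)) ℂ :=
  MvPolynomial.aeval fun j : Fin (a * b + 1) => coeffC a b (j : ℕ)

/-- `T` as a univariate polynomial in the variable `u`. -/
noncomputable def slice {ι : Type*} [DecidableEq ι] (u : ι) :
    MvPolynomial ι ℂ →ₐ[ℂ] Polynomial (MvPolynomial ι ℂ) :=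
  aeval fun v => if v = u then Polynomial.X else Polynomial.C (X v)

section Slice

variable {ι : Type*} [DecidableEq ι]

theorem slice_X_self (u : ι) : slice u (X u) = Polynomial.X := by simp [slice]

theorem slice_X_of_ne {u v : ι} (h : v ≠ u) : slice u (X v) = Polynomial.C (X v) := by
  simp [slice, h]

theorem slice_C (u : ι) (c : ℂ) : slice u (C c) = Polynomial.C (C c) := by
  rw [slice, ← MvPolynomial.algebraMap_eq, AlgHom.commutes, Polynomial.algebraMap_apply,
    MvPolynomial.algebraMap_eq]

/-- The coefficient of `X u ^ k` in `T`. -/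
noncomputable def cf (u : ι) (k : ℕ) : MvPolynomial ι ℂ →ₗ[ℂ] MvPolynomial ι ℂ :=
  ((Polynomial.lcoeff (MvPolynomial ι ℂ) k).restrictScalars ℂ) ∘ₗ (slice u).toLinearMap

theorem cf_apply (u : ι) (k : ℕ) (T : MvPolynomial ι ℂ) : cf u k T = (slice u T).coeff k := rfl

theorem cf_X_self_mul_succ (u : ι) (k : ℕ) (T : MvPolynomial ι ℂ) :
    cf u (k + 1) (X u * T) = cf u k T := by
  simp [cf_apply, slice_X_self, Polynomial.coeff_X_mul]

theorem cf_X_self_mul_zero (u : ι) (T : MvPolynomial ι ℂ) : cf u 0 (X u * T) = 0 := by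
  simp [cf_apply, slice_X_self]

theorem cf_X_mul {u v : ι} (h : v ≠ u) (k : ℕ) (T : MvPolynomial ι ℂ) :
    cf u k (X v * T) = X v * cf u k T := by
  simp [cf_apply, slice_X_of_ne h, Polynomial.coeff_C_mul]

theorem coeff_cf (u : ι) (k : ℕ) (T : MvPolynomial ι ℂ) (s : ι →₀ ℕ) :
    coeff s (cf u k T) = if s u = 0 then coeff (s + Finsupp.single u k) T else 0 := by
  induction T using MvPolynomial.induction_on generalizing k s with
  | C c =>
    rw [cf_apply, slice_C, Polynomial.coeff_C]
    by_cases hk : k = 0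
    · subst hk
      by_cases hs : s u = 0
      · simp [hs]
      · have : (0 : ι →₀ ℕ) ≠ s := by rintro rfl; simp at hs
        simp [hs, coeff_C, this]
    · have : (0 : ι →₀ ℕ) ≠ s + Finsupp.single u k := by
        intro h
        have := DFunLike.congr_fun h u
        simp at this; omega
      simp [hk, coeff_C, this]
  | add p q hp hq =>
    rw [map_add, coeff_add, hp, hq, coeff_add]; split_ifs <;> simp
  | mul_X p v hp =>
    rw [mul_comm]
    by_cases h : v = u
    · subst h
      cases k with
      | zero =>
        rw [cf_X_self_mul_zero]
        simp only [coeff_zero, coeff_X_mul']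
        split_ifs with h1 h2
        · simp [h1] at h2
        · rfl
        · rfl
      | succ k =>
        rw [cf_X_self_mul_succ, hp]
        split_ifs with h1
        · have : s + Finsupp.single v (k + 1) = Finsupp.single v 1 + (s + Finsupp.single v k) := by
            rw [Finsupp.single_add]; abel
          rw [this, coeff_X_mul]
        · rfl
    · rw [cf_X_mul h, coeff_X_mul', coeff_X_mul']
      by_cases hv : v ∈ s.support
      · have hv1 : v ∈ (s + Finsupp.single u k).support := by
          simp only [Finsupp.mem_support_iff, Finsupp.add_apply] at hv ⊢; omega
        have h2 : s + Finsupp.single u k - Finsupp.single v 1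
            = s - Finsupp.single v 1 + Finsupp.single u k := by
          ext w
          simp only [Finsupp.mem_support_iff] at hv
          simp only [Finsupp.add_apply, Finsupp.tsub_apply, Finsupp.single_apply]
          split_ifs <;> first | omega | (subst_vars; omega)
        have h3 : (s - Finsupp.single v 1 : ι →₀ ℕ) u = s u := by simp [h]
        rw [if_pos hv, if_pos hv1, hp, h2, h3]
      · have hv1 : v ∉ (s + Finsupp.single u k).support := by
          simp only [Finsupp.mem_support_iff, Finsupp.add_apply, Finsupp.single_apply] at hv ⊢
          rw [if_neg (Ne.symm h)]; omega
        rw [if_neg hv, if_neg hv1]; simp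

theorem cf_pderiv_self (u : ι) (k : ℕ) (T : MvPolynomial ι ℂ) :
    cf u k (pderiv u T) = ((k : ℂ) + 1) • cf u (k + 1) T := by
  ext s
  rw [coeff_cf, coeff_smul, coeff_cf, coeff_pderiv]
  split_ifs with h
  · rw [Finsupp.single_add, add_assoc]; simp [h, mul_comm]
  · simp

theorem cf_pderiv {u v : ι} (h : v ≠ u) (k : ℕ) (T : MvPolynomial ι ℂ) :
    cf u k (pderiv v T) = pderiv v (cf u k T) := by
  ext s
  rw [coeff_cf, coeff_pderiv, coeff_pderiv, coeff_cf]
  have h1 : (s + Finsupp.single v 1 : ι →₀ ℕ) u = s u := by simp [h]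
  have h2 : (s + Finsupp.single u k) v = s v := by simp [Ne.symm h]
  rw [h1, h2, add_right_comm]
  split_ifs <;> simp

theorem slice_rename {κ : Type*} [DecidableEq κ] (f : ι → κ) (u : ι)
    (hf : ∀ v, v ≠ u → f v ≠ f u) (T : MvPolynomial ι ℂ) :
    slice (f u) (rename f T) = (slice u T).map (rename f).toRingHom := by
  induction T using MvPolynomial.induction_on with
  | C c => rw [rename_C, slice_C, slice_C, Polynomial.map_C]; simp
  | add p q hp hq => simp only [map_add, hp, hq, Polynomial.map_add]
  | mul_X p v hp =>
    simp only [map_mul, hp, Polynomial.map_mul, rename_X]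
    by_cases h : v = u
    · subst h; simp [slice_X_self]
    · rw [slice_X_of_ne h, slice_X_of_ne (hf v h)]; simp

theorem cf_rename {κ : Type*} [DecidableEq κ] (f : ι → κ) (u : ι)
    (hf : ∀ v, v ≠ u → f v ≠ f u) (k : ℕ) (T : MvPolynomial ι ℂ) :
    cf (f u) k (rename f T) = rename f (cf u k T) := by
  rw [cf_apply, slice_rename f u hf, Polynomial.coeff_map]; rfl

theorem eq_zero_of_cf (u : ι) {T : MvPolynomial ι ℂ} (h : ∀ k, cf u k T = 0) : T = 0 := by
  ext s
  have := coeff_cf u (s u) T (s.erase u)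
  rw [h, Finsupp.erase_same, if_pos rfl, Finsupp.erase_add_single] at this
  simpa using this.symm

/-- The degree of `T` in the variable `u`. -/
noncomputable def vdeg (u : ι) (T : MvPolynomial ι ℂ) : ℕ := (slice u T).natDegree

theorem vdeg_le_iff {u : ι} {T : MvPolynomial ι ℂ} {m : ℕ} :
    vdeg u T ≤ m ↔ ∀ k, m < k → cf u k T = 0 :=
  Polynomial.natDegree_le_iff_coeff_eq_zero

theorem cf_vdeg_ne_zero (u : ι) {T : MvPolynomial ι ℂ} (h : T ≠ 0) : cf u (vdeg u T) T ≠ 0 := by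
  intro h0
  rw [cf_apply, vdeg, Polynomial.coeff_natDegree, Polynomial.leadingCoeff_eq_zero] at h0
  exact h (eq_zero_of_cf u fun k => by rw [cf_apply, h0, Polynomial.coeff_zero])

theorem le_vdeg_of_coeff_ne_zero (u : ι) {T : MvPolynomial ι ℂ} {s : ι →₀ ℕ}
    (h : coeff s T ≠ 0) : s u ≤ vdeg u T := by
  by_contra hlt
  have h1 := vdeg_le_iff.1 le_rfl (s u) (not_le.1 hlt)
  have := coeff_cf u (s u) T (s.erase u)
  rw [h1, Finsupp.erase_same, if_pos rfl, Finsupp.erase_add_single] at this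
  exact h (by simpa using this.symm)

theorem vdeg_swap (u v : ι) (T : MvPolynomial ι ℂ) :
    vdeg v (rename (Equiv.swap u v) T) = vdeg u T := by
  have := slice_rename (Equiv.swap u v) u (fun w hw => (Equiv.swap u v).injective.ne hw) T
  rw [Equiv.swap_apply_left] at this
  rw [vdeg, vdeg, this]
  exact Polynomial.natDegree_map_eq_of_injective (rename_injective _ (Equiv.swap u v).injective) _

/-- If `(X u - X v) * h` has degree at most `m` in `u`, then `h` has degree less than `m`. -/
theorem cf_eq_zero_of_sub_mul {u v : ι} (huv : u ≠ v) {h : MvPolynomial ι ℂ} {m : ℕ}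
    (hm : vdeg u ((X u - X v) * h) ≤ m) {k : ℕ} (hk : m ≤ k) : cf u k h = 0 := by
  rw [vdeg_le_iff] at hm
  have step : ∀ j, m ≤ j → cf u (j + 1) h = 0 → cf u j h = 0 := by
    intro j hj h0
    have := hm (j + 1) (by omega)
    rwa [sub_mul, map_sub, cf_X_self_mul_succ, cf_X_mul huv.symm, h0, mul_zero, sub_zero] at this
  have hb : ∀ n, ∀ j, m ≤ j → vdeg u h < j + n → cf u j h = 0 := by
    intro n
    induction n with
    | zero => intro j _ hj2; exact vdeg_le_iff.1 le_rfl _ (by omega)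
    | succ n ih => intro j hj hj2; exact step j hj (ih (j + 1) (by omega) (by omega))
  exact hb (vdeg u h + 1) k hk (by omega)

end Slice

section Operators

variable {ι : Type*} [DecidableEq ι]

/-- `U` is the image of `T` under the second-order operator attached to the weights `e` on the
variables in `A`; the quotients `h u v` are required to be polynomial. -/
def ERel (a : ℕ) (e : ι → ℕ) (A : Finset ι) (T U : MvPolynomial ι ℂ) : Prop :=
  ∃ h : ι → ι → MvPolynomial ι ℂ,
    (∀ u ∈ A, ∀ v ∈ A, u ≠ v →
      (X u - X v) * h u v = (e v : ℂ) • pderiv u T - (e u : ℂ) • pderiv v T) ∧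
    U = ∑ u ∈ A, (((a : ℂ) / e u) • (X u * pderiv u (pderiv u T))
          - ((e u : ℂ) - 1) • pderiv u T)
        - ∑ u ∈ A, ∑ v ∈ A.erase u, ((e u : ℂ) • pderiv v T + X u * h u v)

/-- The sum of the partial derivatives along `A`. -/
noncomputable def fop (A : Finset ι) : MvPolynomial ι ℂ →ₗ[ℂ] MvPolynomial ι ℂ :=
  ∑ u ∈ A, (pderiv u).toLinearMap

theorem fop_apply {σ : Type*} (A : Finset σ) (T : MvPolynomial σ ℂ) :
    fop A T = ∑ u ∈ A, pderiv u T := by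
  simp [fop]

theorem cf_fop {A : Finset ι} {w : ι} (hw : w ∈ A) {k : ℕ} {T : MvPolynomial ι ℂ}
    (hT : vdeg w T ≤ k) : cf w k (fop A T) = fop (A.erase w) (cf w k T) := by
  rw [fop_apply, fop_apply, map_sum, ← Finset.add_sum_erase A _ hw, cf_pderiv_self,
    vdeg_le_iff.1 hT _ (Nat.lt_succ_self k), smul_zero, zero_add]
  exact Finset.sum_congr rfl fun v hv => cf_pderiv (Finset.ne_of_mem_erase hv) k T

theorem vdeg_pderiv_le {u v : ι} {k : ℕ} {T : MvPolynomial ι ℂ} (hT : vdeg u T ≤ k) :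
    vdeg u (pderiv v T) ≤ k := by
  rw [vdeg_le_iff] at hT ⊢
  intro j hj
  by_cases h : v = u
  · subst h; rw [cf_pderiv_self, hT _ (by omega), smul_zero]
  · rw [cf_pderiv h, hT _ hj, map_zero]

theorem vdeg_smul_sub_smul_le {u : ι} {k : ℕ} {T U : MvPolynomial ι ℂ} (c d : ℂ)
    (hT : vdeg u T ≤ k) (hU : vdeg u U ≤ k) : vdeg u (c • T - d • U) ≤ k := by
  rw [vdeg_le_iff] at *
  intro j hj
  rw [map_sub, map_smul, map_smul, hT j hj, hU j hj, smul_zero, smul_zero, sub_zero]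

theorem ERel.eq_zero {a : ℕ} {e : ι → ℕ} {A : Finset ι} {U : MvPolynomial ι ℂ}
    (h : ERel a e A 0 U) : U = 0 := by
  obtain ⟨h, h1, h2⟩ := h
  rw [h2]
  have h0 : ∀ u ∈ A, ∀ v ∈ A, u ≠ v → h u v = 0 := by
    intro u hu v hv huv
    have := h1 u hu v hv huv
    rw [map_zero, map_zero, smul_zero, smul_zero, sub_zero] at this
    refine (mul_eq_zero.1 this).resolve_left fun hx => huv (X_injective (sub_eq_zero.1 hx))
  rw [Finset.sum_eq_zero, Finset.sum_eq_zero, sub_zero]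
  · intro u hu
    refine Finset.sum_eq_zero fun v hv => ?_
    rw [h0 u hu v (Finset.mem_of_mem_erase hv) (Finset.ne_of_mem_erase hv).symm]
    simp
  · intro u _; simp

theorem ERel.cf {a : ℕ} {e : ι → ℕ} {A : Finset ι} {T U : MvPolynomial ι ℂ}
    (h : ERel a e A T U) {w : ι} (hw : w ∈ A) {k : ℕ} (hT : vdeg w T ≤ k) :
    ERel a e (A.erase w) (cf w k T) (cf w k U) := by
  obtain ⟨h, h1, h2⟩ := h
  have hd : ∀ u ∈ A, ∀ v ∈ A, u ≠ v → vdeg w ((X u - X v) * h u v) ≤ k := by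
    intro u hu v hv huv
    rw [h1 u hu v hv huv]
    exact vdeg_smul_sub_smul_le _ _ (vdeg_pderiv_le hT) (vdeg_pderiv_le hT)
  refine ⟨fun u v => _root_.cf w k (h u v), ?_, ?_⟩
  · intro u hu v hv huv
    have hu' := Finset.ne_of_mem_erase hu
    have hv' := Finset.ne_of_mem_erase hv
    have := congrArg (_root_.cf w k)
      (h1 u (Finset.mem_of_mem_erase hu) v (Finset.mem_of_mem_erase hv) huv)
    rw [sub_mul, map_sub, cf_X_mul hu', cf_X_mul hv', map_sub, map_smul, map_smul,
      cf_pderiv hu', cf_pderiv hv'] at this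
    rw [sub_mul, this]
  · have hself : _root_.cf w k (pderiv w T) = 0 := by
      rw [cf_pderiv_self, vdeg_le_iff.1 hT _ (Nat.lt_succ_self k), smul_zero]
    have hself2 : _root_.cf w k (X w * pderiv w (pderiv w T)) = 0 := by
      cases k with
      | zero => exact cf_X_self_mul_zero _ _
      | succ k =>
        rw [cf_X_self_mul_succ, cf_pderiv_self, cf_pderiv_self,
          vdeg_le_iff.1 hT _ (by omega), smul_zero, smul_zero]
    have hwv : ∀ v ∈ A.erase w,
        _root_.cf w k ((e w : ℂ) • pderiv v T + X w * h w v) = 0 := by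
      intro v hv
      have hv' := Finset.ne_of_mem_erase hv
      have hvA := Finset.mem_of_mem_erase hv
      have hz : _root_.cf w k (h w v) = 0 :=
        cf_eq_zero_of_sub_mul hv'.symm (hd w hw v hvA hv'.symm) le_rfl
      have := congrArg (_root_.cf w k) (h1 w hw v hvA hv'.symm)
      rw [sub_mul, map_sub, cf_X_mul hv', hz, mul_zero, sub_zero, map_sub, map_smul, map_smul,
        hself, smul_zero, zero_sub] at this
      rw [map_add, map_smul, this, add_neg_cancel]
    have hvw : ∀ v ∈ A.erase w,
        _root_.cf w k ((e v : ℂ) • pderiv w T + X v * h v w) = 0 := by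
      intro v hv
      have hv' := Finset.ne_of_mem_erase hv
      have hvA := Finset.mem_of_mem_erase hv
      have hz : _root_.cf w k (h v w) = 0 := by
        refine cf_eq_zero_of_sub_mul hv'.symm (m := k) ?_ le_rfl
        have h3 : (X w - X v) * h v w
            = (e v : ℂ) • pderiv w T - (e w : ℂ) • pderiv v T := by
          rw [← neg_sub, neg_mul, h1 v hvA w hw hv', neg_sub]
        rw [h3]
        exact vdeg_smul_sub_smul_le _ _ (vdeg_pderiv_le hT) (vdeg_pderiv_le hT)
      rw [map_add, map_smul, hself, cf_X_mul hv', hz, mul_zero, smul_zero, zero_add]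
    rw [h2, map_sub, map_sum, map_sum, ← Finset.add_sum_erase A _ hw,
      ← Finset.add_sum_erase A (fun u => _root_.cf w k (∑ v ∈ A.erase u, _)) hw,
      map_sub, map_smul, map_smul, hself, hself2, smul_zero, smul_zero, sub_zero, zero_add,
      map_sum, Finset.sum_eq_zero hwv, zero_add]
    congr 1
    · refine Finset.sum_congr rfl fun u hu => ?_
      have hu' := Finset.ne_of_mem_erase hu
      rw [map_sub, map_smul, map_smul, cf_X_mul hu', cf_pderiv hu', cf_pderiv hu']
    · refine Finset.sum_congr rfl fun u hu => ?_
      have hu' := Finset.ne_of_mem_erase hu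
      rw [map_sum, ← Finset.add_sum_erase (A.erase u) _ (Finset.mem_erase.2 ⟨hu'.symm, hw⟩),
        hvw u hu, zero_add, Finset.erase_right_comm]
      refine Finset.sum_congr rfl fun v hv => ?_
      have hv' := Finset.ne_of_mem_erase (Finset.mem_of_mem_erase hv)
      rw [map_add, map_smul, cf_X_mul hu', cf_pderiv hv']

theorem ERel.vdeg_le {a : ℕ} {e : ι → ℕ} {A : Finset ι} {T U : MvPolynomial ι ℂ}
    (h : ERel a e A T U) {w : ι} (hw : w ∈ A) {k : ℕ} (hT : vdeg w T ≤ k) : vdeg w U ≤ k := by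
  rw [vdeg_le_iff]
  intro j hj
  have := h.cf hw (hT.trans hj.le)
  rw [vdeg_le_iff.1 hT j hj] at this
  exact this.eq_zero

theorem vdeg_fop_le {A : Finset ι} {w : ι} {k : ℕ} {T : MvPolynomial ι ℂ}
    (hT : vdeg w T ≤ k) : vdeg w (fop A T) ≤ k := by
  rw [vdeg_le_iff]
  intro j hj
  rw [fop_apply, map_sum]
  exact Finset.sum_eq_zero fun u _ => vdeg_le_iff.1 (vdeg_pderiv_le hT) j hj

end Operators

section Ode

variable {ι : Type*} [DecidableEq ι]

/-- A constant nonzero coefficient of `X u ^ (m + 1)` in a solution forces a numerical identity. -/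
theorem ERel.index_eq {a : ℕ} {e : ι → ℕ} {A : Finset ι} {T : MvPolynomial ι ℂ}
    (hE : ERel a e A T 0) (hf : fop A T = 0) {u : ι} (hu : u ∈ A) (heu : e u ≠ 0) {m : ℕ}
    (hc : constantCoeff (_root_.cf u (m + 1) T) ≠ 0) : a * m = e u * ∑ v ∈ A, e v := by
  obtain ⟨h, h1, h2⟩ := hE
  let τ : MvPolynomial ι ℂ →ₗ[ℂ] ℂ := lcoeff ℂ 0 ∘ₗ _root_.cf u m
  have hτ : ∀ T, τ T = constantCoeff (_root_.cf u m T) := fun T => rfl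
  have hXv : ∀ v, v ≠ u → ∀ T, τ (X v * T) = 0 := by
    intro v hv T; rw [hτ, cf_X_mul hv]; simp
  have hXu : τ (X u * pderiv u (pderiv u T)) = m * τ (pderiv u T) := by
    rw [hτ, hτ]
    cases m with
    | zero => rw [cf_X_self_mul_zero]; simp
    | succ m =>
      rw [cf_X_self_mul_succ, cf_pderiv_self]
      simp only [constantCoeff_smul, smul_eq_mul]
      push_cast
      ring
  have ht : τ (pderiv u T) ≠ 0 := by
    rw [hτ, cf_pderiv_self, smul_eq_C_mul, map_mul, constantCoeff_C]
    exact mul_ne_zero (by exact_mod_cast Nat.succ_ne_zero m) hc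
  set t := τ (pderiv u T) with htdef
  set g : ι → ℂ := fun v => τ (pderiv v T) with hg
  have hfg : t + ∑ v ∈ A.erase u, g v = 0 := by
    have := congrArg τ hf
    rwa [fop_apply, map_sum, map_zero, ← Finset.add_sum_erase A _ hu] at this
  have hpair : ∀ v ∈ A.erase u, τ (X u * h u v) = e v * t - e u * g v := by
    intro v hv
    have hv' := Finset.ne_of_mem_erase hv
    have := congrArg τ (h1 u hu v (Finset.mem_of_mem_erase hv) hv'.symm)
    rwa [sub_mul, map_sub, hXv v hv', sub_zero, map_sub, map_smul, map_smul, smul_eq_mul,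
      smul_eq_mul] at this
  have key := congrArg τ h2
  rw [map_zero, map_sub, map_sum, map_sum, ← Finset.add_sum_erase A _ hu,
    ← Finset.add_sum_erase A (fun u => τ (∑ v ∈ A.erase u, _)) hu, map_sub, map_smul, map_smul,
    hXu] at key
  have e1 : ∑ v ∈ A.erase u, τ (((a : ℂ) / e v) • (X v * pderiv v (pderiv v T))
      - ((e v : ℂ) - 1) • pderiv v T) = ∑ v ∈ A.erase u, (-(e v * g v) + g v) := by
    refine Finset.sum_congr rfl fun v hv => ?_
    rw [map_sub, map_smul, map_smul, hXv v (Finset.ne_of_mem_erase hv)]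
    simp only [smul_eq_mul, hg]; ring
  have e2 : τ (∑ v ∈ A.erase u, ((e u : ℂ) • pderiv v T + X u * h u v))
      = (∑ v ∈ A.erase u, (e v : ℂ)) * t := by
    rw [map_sum, Finset.sum_mul]
    refine Finset.sum_congr rfl fun v hv => ?_
    rw [map_add, map_smul, hpair v hv, smul_eq_mul]; ring
  have e3 : ∑ v ∈ A.erase u, τ (∑ w ∈ A.erase v, ((e v : ℂ) • pderiv w T + X v * h v w))
      = ∑ v ∈ A.erase u, -(e v * g v) := by
    refine Finset.sum_congr rfl fun v hv => ?_
    have hgv : g v + ∑ w ∈ A.erase v, g w = 0 := by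
      rw [Finset.add_sum_erase A g (Finset.mem_of_mem_erase hv), ← Finset.add_sum_erase A g hu, hfg]
    rw [map_sum, eq_neg_of_add_eq_zero_left hgv, mul_neg, neg_neg, Finset.mul_sum]
    refine Finset.sum_congr rfl fun w _ => ?_
    rw [map_add, map_smul, hXv v (Finset.ne_of_mem_erase hv), add_zero, smul_eq_mul]
  rw [e1, e2, e3, Finset.sum_add_distrib] at key
  have heu' : (e u : ℂ) ≠ 0 := by exact_mod_cast heu
  have hN : (a * m : ℂ) = e u * (e u + ∑ v ∈ A.erase u, (e v : ℂ)) := by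
    refine mul_right_cancel₀ ht ?_
    simp only [smul_eq_mul] at key
    field_simp at key
    linear_combination -key - e u * hfg
  rw [← Finset.add_sum_erase A e hu]
  exact_mod_cast hN

end Ode

section Solutions

variable {ι : Type*} [DecidableEq ι]

theorem degree_add_single {σ : Type*} (s : σ →₀ ℕ) (u : σ) (k : ℕ) :
    (s + Finsupp.single u k).degree = s.degree + k := by
  rw [map_add, Finsupp.degree_single]

theorem pderiv_homogeneousComponent {σ : Type*} (v : σ) (d : ℕ) (T : MvPolynomial σ ℂ) :
    pderiv v (homogeneousComponent (d + 1) T) = homogeneousComponent d (pderiv v T) := by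
  ext s
  rw [coeff_pderiv, coeff_homogeneousComponent, coeff_homogeneousComponent, coeff_pderiv,
    degree_add_single]
  simp only [add_left_inj, ite_mul, zero_mul]

theorem homogeneousComponent_X_mul (v : ι) (d : ℕ) (T : MvPolynomial ι ℂ) :
    homogeneousComponent (d + 1) (X v * T) = X v * homogeneousComponent d T := by
  ext s
  rw [coeff_homogeneousComponent, coeff_X_mul', coeff_X_mul', coeff_homogeneousComponent]
  by_cases hv : v ∈ s.support
  · obtain ⟨t, rfl⟩ : ∃ t, s = t + Finsupp.single v 1 := by
      refine ⟨s - Finsupp.single v 1, (tsub_add_cancel_of_le ?_).symm⟩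
      rw [Finsupp.single_le_iff]
      exact Nat.one_le_iff_ne_zero.2 (Finsupp.mem_support_iff.1 hv)
    rw [degree_add_single, add_tsub_cancel_right]
    simp [hv]
  · simp [hv]

theorem homogeneousComponent_zero_X_mul {σ : Type*} (v : σ) (T : MvPolynomial σ ℂ) :
    homogeneousComponent 0 (X v * T) = 0 := by
  rw [homogeneousComponent_zero, ← constantCoeff_eq, map_mul, constantCoeff_X, zero_mul, C_0]

theorem degree_eq_of_coeff_ne_zero {σ : Type*} {T : MvPolynomial σ ℂ} {d : ℕ}
    (hT : T.IsHomogeneous d) {s : σ →₀ ℕ} (hs : coeff s T ≠ 0) : s.degree = d := by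
  by_contra h
  exact hs (hT.coeff_eq_zero h)

theorem isHomogeneous_cf {T : MvPolynomial ι ℂ} {d : ℕ} (hT : T.IsHomogeneous d) (u : ι) (k : ℕ) :
    (cf u k T).IsHomogeneous (d - k) := by
  intro s hs
  rw [coeff_cf] at hs
  have := degree_eq_of_coeff_ne_zero hT (s := s + Finsupp.single u k)
    (by intro h; simp [h] at hs)
  rw [degree_add_single] at this
  have h2 : s.degree = d - k := by omega
  rwa [Finsupp.degree_eq_weight_one] at h2

theorem degree_eq_sum_of_subset {s : ι →₀ ℕ} {A : Finset ι} (h : ∀ v, v ∉ A → s v = 0) :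
    s.degree = ∑ v ∈ A, s v := by
  rw [Finsupp.degree]
  refine Finset.sum_subset (fun v hv => ?_) fun v _ hv => by simpa using hv
  by_contra hvA
  exact (Finsupp.mem_support_iff.1 hv) (h v hvA)

/-- Translation-invariant solutions of the second-order equation attached to `A` and `e`. -/
structure IsSol (a : ℕ) (e : ι → ℕ) (A : Finset ι) (T : MvPolynomial ι ℂ) : Prop where
  supp : ∀ s, coeff s T ≠ 0 → ∀ v, v ∉ A → s v = 0
  sym : ∀ u ∈ A, ∀ v ∈ A, e u = e v → rename (Equiv.swap u v) T = T
  low : fop A T = 0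
  second : ERel a e A T 0

theorem supp_cf {A : Finset ι} {T : MvPolynomial ι ℂ}
    (h : ∀ s, coeff s T ≠ 0 → ∀ v, v ∉ A → s v = 0) (u : ι) (k : ℕ) :
    ∀ s, coeff s (cf u k T) ≠ 0 → ∀ v, v ∉ A.erase u → s v = 0 := by
  intro s hs v hv
  rw [coeff_cf] at hs
  by_cases hu : s u = 0
  · by_cases hvu : v = u
    · rw [hvu, hu]
    · rw [if_pos hu] at hs
      have := h _ hs v fun hvA => hv (Finset.mem_erase.2 ⟨hvu, hvA⟩)
      rw [Finsupp.add_apply] at this; omega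
  · simp [hu] at hs

theorem sym_cf {e : ι → ℕ} {A : Finset ι} {T : MvPolynomial ι ℂ}
    (h : ∀ u ∈ A, ∀ v ∈ A, e u = e v → rename (Equiv.swap u v) T = T) (w : ι) (k : ℕ) :
    ∀ u ∈ A.erase w, ∀ v ∈ A.erase w, e u = e v →
      rename (Equiv.swap u v) (cf w k T) = cf w k T := by
  intro u hu v hv huv
  rw [Finset.mem_erase] at hu hv
  have hw : Equiv.swap u v w = w := Equiv.swap_apply_of_ne_of_ne hu.1.symm hv.1.symm
  have := cf_rename (Equiv.swap u v) w (fun x hx => (Equiv.swap u v).injective.ne hx) k T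
  rw [← this, hw, h u hu.2 v hv.2 huv]

theorem vdeg_eq_of_sym {e : ι → ℕ} {A : Finset ι} {T : MvPolynomial ι ℂ}
    (h : ∀ u ∈ A, ∀ v ∈ A, e u = e v → rename (Equiv.swap u v) T = T) {u v : ι}
    (hu : u ∈ A) (hv : v ∈ A) (huv : e u = e v) : vdeg v T = vdeg u T := by
  conv_lhs => rw [← h u hu v hv huv]
  exact vdeg_swap u v T

theorem eq_C_of_supp_empty {T : MvPolynomial ι ℂ}
    (h : ∀ s, coeff s T ≠ 0 → ∀ v, v ∉ (∅ : Finset ι) → s v = 0) : T = C (coeff 0 T) := by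
  ext s
  rw [coeff_C]
  split_ifs with h0
  · rw [h0]
  · by_contra hs
    exact h0 (Finsupp.ext fun v => (h s hs v (Finset.notMem_empty v)).symm)

variable {a : ℕ} {e : ι → ℕ} {A : Finset ι} {T : MvPolynomial ι ℂ}

theorem IsSol.cf (h : IsSol a e A T) {u : ι} (hu : u ∈ A) {k : ℕ} (hT : vdeg u T ≤ k) :
    IsSol a e (A.erase u) (_root_.cf u k T) where
  supp := supp_cf h.supp u k
  sym := sym_cf h.sym u k
  low := by rw [← cf_fop hu hT, h.low, map_zero]
  second := by simpa using h.second.cf hu hT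

theorem ERel.homogeneousComponent (h : ERel a e A T 0) (d : ℕ) :
    ERel a e A (MvPolynomial.homogeneousComponent (d + 1) T) 0 := by
  obtain ⟨h, h1, h2⟩ := h
  let H : MvPolynomial ι ℂ → MvPolynomial ι ℂ :=
    fun p => if d = 0 then 0 else MvPolynomial.homogeneousComponent (d - 1) p
  have hX : ∀ v p, MvPolynomial.homogeneousComponent d (X v * p) = X v * H p := by
    intro v p
    cases d with
    | zero => rw [homogeneousComponent_zero_X_mul]; simp [H]
    | succ d => simp [H, homogeneousComponent_X_mul]
  have hX2 : ∀ (v : ι) (p : MvPolynomial ι ℂ),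
      X v * pderiv v (pderiv v (MvPolynomial.homogeneousComponent (d + 1) p)) =
      X v * H (pderiv v (pderiv v p)) := by
    intro v p
    rw [pderiv_homogeneousComponent, ← hX]
    cases d with
    | zero =>
      rw [homogeneousComponent_zero_X_mul, MvPolynomial.homogeneousComponent_zero, pderiv_C,
        mul_zero]
    | succ d => rw [homogeneousComponent_X_mul, pderiv_homogeneousComponent]
  refine ⟨fun u v => H (h u v), ?_, ?_⟩
  · intro u hu v hv huv
    have := congrArg (MvPolynomial.homogeneousComponent d) (h1 u hu v hv huv)
    rw [sub_mul, map_sub, hX, hX, map_sub, map_smul, map_smul] at this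
    rw [pderiv_homogeneousComponent, pderiv_homogeneousComponent, sub_mul, this]
  · have := congrArg (MvPolynomial.homogeneousComponent d) h2
    simp only [map_zero, map_sub, map_sum, map_add, map_smul, hX] at this
    simp only [hX2]
    simp only [pderiv_homogeneousComponent]
    exact this

theorem IsSol.homogeneousComponent (h : IsSol a e A T) (d : ℕ) :
    IsSol a e A (MvPolynomial.homogeneousComponent (d + 1) T) where
  supp s hs := h.supp s fun h0 => hs (by rw [coeff_homogeneousComponent, h0, ite_self])
  sym u hu v hv huv := by rw [rename_homogeneousComponent, h.sym u hu v hv huv]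
  low := by
    have := congrArg (MvPolynomial.homogeneousComponent d) h.low
    rw [fop_apply, map_sum, map_zero] at this
    simpa only [fop_apply, pderiv_homogeneousComponent] using this
  second := h.second.homogeneousComponent d

/-- Degree bound for homogeneous solutions when all weights equal `a`. -/
theorem IsSol.degree_ge (ha : 1 ≤ a) (h : IsSol a e A T) (hA : ∀ u ∈ A, e u = a) (hT : T ≠ 0)
    {d : ℕ} (hd : T.IsHomogeneous d) (hd0 : d ≠ 0) : a * A.card + 1 ≤ d := by
  induction hn : A.card generalizing A T d with
  | zero =>
    obtain rfl := Finset.card_eq_zero.1 hn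
    have hTC := eq_C_of_supp_empty h.supp
    obtain ⟨s, hs⟩ := ne_zero_iff.1 hT
    have h1 := degree_eq_of_coeff_ne_zero hd hs
    have h2 : s = 0 := Finsupp.ext fun v => h.supp s hs v (Finset.notMem_empty v)
    rw [h2, map_zero] at h1
    exact absurd h1.symm hd0
  | succ n ih =>
    obtain ⟨r, hr⟩ := Finset.card_pos.1 (by omega : 0 < A.card)
    set m := vdeg r T with hm
    have ht := cf_vdeg_ne_zero r hT
    have hsol := h.cf hr le_rfl
    have hhom := isHomogeneous_cf hd r m
    have hcard : (A.erase r).card = n := by rw [Finset.card_erase_of_mem hr, hn]; rfl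
    obtain ⟨s, hs⟩ := ne_zero_iff.1 ht
    have hsA := hsol.supp s hs
    have hsd := degree_eq_of_coeff_ne_zero hhom hs
    have hs' : coeff (s + Finsupp.single r m) T ≠ 0 := by
      rw [coeff_cf] at hs
      intro h0; rw [h0, ite_self] at hs; exact hs rfl
    have hdm : s.degree + m = d := by
      rw [← degree_add_single s r m]
      exact degree_eq_of_coeff_ne_zero hd hs'
    by_cases hδ : d - m = 0
    · have hs0 : s = 0 := (Finsupp.degree_eq_zero_iff s).1 (by omega)
      obtain ⟨k, hk⟩ : ∃ k, m = k + 1 := Nat.exists_eq_succ_of_ne_zero (by omega)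
      have := h.second.index_eq h.low hr (by rw [hA r hr]; omega) (m := k) (by
        rw [← hk, constantCoeff_eq, ← hs0]; exact hs)
      rw [hA r hr, Finset.sum_congr rfl hA, Finset.sum_const, hn, smul_eq_mul] at this
      have := Nat.eq_of_mul_eq_mul_left (by omega) this
      rw [mul_comm] at this
      omega
    · have h1 := ih hsol (fun u hu => hA u (Finset.mem_of_mem_erase hu)) ht hhom hδ hcard
      have h2 : s.degree ≤ n * m := by
        rw [degree_eq_sum_of_subset hsA, ← hcard]
        refine Finset.sum_le_card_nsmul _ _ _ fun v hv => ?_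
        have hvA := Finset.mem_of_mem_erase hv
        have h3 := le_vdeg_of_coeff_ne_zero v hs'
        rw [Finsupp.add_apply, vdeg_eq_of_sym h.sym hr hvA ((hA r hr).trans (hA v hvA).symm)] at h3
        omega
      have h4 : a < m := by
        by_contra hle
        have := Nat.mul_le_mul_left n (not_lt.1 hle)
        rw [mul_comm n a] at this
        omega
      rw [mul_add]
      omega

end Solutions

section StableSpaces

variable {ι : Type*} [DecidableEq ι]

/-- A space of polynomials in the variables `A` stable under the two operators, symmetric, and
vanishing when `a` variables of weight one collide. -/
structure Stable (a : ℕ) (e : ι → ℕ) (A : Finset ι) (W : Submodule ℂ (MvPolynomial ι ℂ)) :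
    Prop where
  supp : ∀ T ∈ W, ∀ s, coeff s T ≠ 0 → ∀ v, v ∉ A → s v = 0
  sym : ∀ T ∈ W, ∀ u ∈ A, ∀ v ∈ A, e u = e v → rename (Equiv.swap u v) T = T
  low : ∀ T ∈ W, fop A T ∈ W
  second : ∀ T ∈ W, ∃ U ∈ W, ERel a e A T U
  van : ∀ S ⊆ A, (∀ v ∈ S, e v = 1) → S.card = a → ∀ c ∈ S, ∀ T ∈ W,
    rename (fun v => if v ∈ S then c else v) T = 0

/-- The coefficients of `X u ^ m` of the elements of `W` of degree at most `m` in `u`. -/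
noncomputable def peel (u : ι) (m : ℕ) (W : Submodule ℂ (MvPolynomial ι ℂ)) :
    Submodule ℂ (MvPolynomial ι ℂ) :=
  (W ⊓ ⨅ k : {k // m < k}, LinearMap.ker (cf u k)).map (cf u m)

theorem mem_peel {u : ι} {m : ℕ} {W : Submodule ℂ (MvPolynomial ι ℂ)} {C : MvPolynomial ι ℂ} :
    C ∈ peel u m W ↔ ∃ T ∈ W, vdeg u T ≤ m ∧ cf u m T = C := by
  simp [peel, vdeg_le_iff, Submodule.mem_iInf, and_assoc]

variable {a : ℕ} {e : ι → ℕ} {A : Finset ι} {W : Submodule ℂ (MvPolynomial ι ℂ)}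

theorem Stable.peel (h : Stable a e A W) {u : ι} (hu : u ∈ A) (m : ℕ) :
    Stable a e (A.erase u) (peel u m W) where
  supp C hC := by
    obtain ⟨T, hT, _, rfl⟩ := mem_peel.1 hC
    exact supp_cf (h.supp T hT) u m
  sym C hC := by
    obtain ⟨T, hT, _, rfl⟩ := mem_peel.1 hC
    exact sym_cf (h.sym T hT) u m
  low C hC := by
    obtain ⟨T, hT, hd, rfl⟩ := mem_peel.1 hC
    exact mem_peel.2 ⟨_, h.low T hT, vdeg_fop_le hd, cf_fop hu hd⟩
  second C hC := by
    obtain ⟨T, hT, hd, rfl⟩ := mem_peel.1 hC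
    obtain ⟨U, hU, hE⟩ := h.second T hT
    exact ⟨_, mem_peel.2 ⟨U, hU, hE.vdeg_le hu hd, rfl⟩, hE.cf hu hd⟩
  van S hS h1 hcard c hc C hC := by
    obtain ⟨T, hT, hd, rfl⟩ := mem_peel.1 hC
    have huS : u ∉ S := fun huS => (Finset.mem_erase.1 (hS huS)).1 rfl
    have := cf_rename (fun v => if v ∈ S then c else v) u (by
      intro v hv
      simp only [if_neg huS]
      split_ifs
      · rintro rfl; exact huS hc
      · exact hv) m T
    rw [← this, h.van S (hS.trans (Finset.erase_subset _ _)) h1 hcard c hc T hT, map_zero]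

theorem ERel.eq_zero_of_pderiv {T U : MvPolynomial ι ℂ} (h : ERel a e A T U)
    (hT : ∀ u, pderiv u T = 0) : U = 0 := by
  refine ERel.eq_zero (a := a) (e := e) (A := A) ?_
  obtain ⟨h, h1, h2⟩ := h
  refine ⟨h, ?_, ?_⟩
  · intro u hu v hv huv
    rw [h1 u hu v hv huv]; simp [hT]
  · rw [h2]; simp [hT]

theorem cf_C (u : ι) (k : ℕ) (c : ℂ) : cf u k (C c) = if k = 0 then C c else 0 := by
  rw [cf_apply, slice_C, Polynomial.coeff_C]

theorem eq_C_of_vdeg_zero {u : ι} {T : MvPolynomial ι ℂ} {c : ℂ} (hT : vdeg u T ≤ 0)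
    (h : cf u 0 T = C c) : T = C c := by
  refine sub_eq_zero.1 (eq_zero_of_cf u fun k => ?_)
  rw [map_sub, cf_C]
  split_ifs with hk
  · rw [hk, h, sub_self]
  · rw [vdeg_le_iff.1 hT k (Nat.pos_of_ne_zero hk), sub_zero]

theorem exists_min_vdeg (u : ι) (hW : W ≠ ⊥) :
    ∃ T ∈ W, T ≠ 0 ∧ ∀ T' ∈ W, T' ≠ 0 → vdeg u T ≤ vdeg u T' := by
  obtain ⟨T, hT, hT0⟩ := Submodule.exists_mem_ne_zero_of_ne_bot hW
  have hne : {T | T ∈ W ∧ T ≠ 0}.Nonempty := ⟨T, hT, hT0⟩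
  refine ⟨Function.argminOn (vdeg u) _ hne, (Function.argminOn_mem (vdeg u) _ hne).1,
    (Function.argminOn_mem (vdeg u) _ hne).2, fun T' hT' h0 => ?_⟩
  exact Function.argminOn_le (vdeg u) {T | T ∈ W ∧ T ≠ 0} ⟨hT', h0⟩

theorem peel_ne_bot {u : ι} {T : MvPolynomial ι ℂ} (hT : T ∈ W) (h0 : T ≠ 0) :
    peel u (vdeg u T) W ≠ ⊥ :=
  Submodule.ne_bot_iff _ |>.2 ⟨_, mem_peel.2 ⟨T, hT, le_rfl, rfl⟩, cf_vdeg_ne_zero u h0⟩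

theorem Stable.exists_isSol (h : Stable a e A W) {u : ι} (hu : u ∈ A) {m : ℕ}
    (hmin : ∀ T ∈ W, T ≠ 0 → m ≤ vdeg u T) (h1 : 1 ∈ _root_.peel u m W) :
    ∃ T ∈ W, IsSol a e A T ∧ vdeg u T ≤ m ∧ cf u m T = 1 := by
  obtain ⟨T, hT, hd, hc⟩ := mem_peel.1 h1
  have hzero : ∀ U ∈ W, vdeg u U ≤ m → cf u m U = 0 → U = 0 := by
    intro U hU hUd hU0
    by_contra hne
    have := cf_vdeg_ne_zero u hne
    rw [le_antisymm hUd (hmin U hU hne)] at this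
    exact this hU0
  refine ⟨T, hT, ⟨h.supp T hT, h.sym T hT, ?_, ?_⟩, hd, hc⟩
  · refine hzero _ (h.low T hT) (vdeg_fop_le hd) ?_
    rw [cf_fop hu hd, hc, fop_apply]
    simp
  · obtain ⟨U, hU, hE⟩ := h.second T hT
    have hE' := hE.cf hu hd
    rw [hc] at hE'
    rw [hzero U hU (hE.vdeg_le hu hd) (hE'.eq_zero_of_pderiv fun u => by simp)] at hE
    exact hE

/-- If the leading coefficient space contains the constants, then either so does `W`, or the
minimal degree is determined by the weights. -/
theorem Stable.one_mem_or (h : Stable a e A W) {u : ι} (hu : u ∈ A) (heu : e u ≠ 0)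
    {m : ℕ} (hmin : ∀ T ∈ W, T ≠ 0 → m ≤ vdeg u T) (h1 : 1 ∈ _root_.peel u m W) :
    1 ∈ W ∨ ∃ k, m = k + 1 ∧ a * k = e u * ∑ v ∈ A, e v := by
  obtain ⟨T, hT, hsol, hd, hc⟩ := h.exists_isSol hu hmin h1
  cases m with
  | zero =>
    left
    rw [← C_1] at hc ⊢
    rw [← eq_C_of_vdeg_zero hd hc]; exact hT
  | succ k =>
    exact Or.inr ⟨k, rfl, hsol.second.index_eq hsol.low hu heu (by rw [hc]; simp)⟩

theorem one_mem_of_supp_empty (h : ∀ T ∈ W, ∀ s, coeff s T ≠ 0 → ∀ v, v ∉ (∅ : Finset ι) → s v = 0)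
    (hW : W ≠ ⊥) : 1 ∈ W := by
  obtain ⟨T, hT, hT0⟩ := Submodule.exists_mem_ne_zero_of_ne_bot hW
  have h1 := eq_C_of_supp_empty (h T hT)
  have hc : coeff 0 T ≠ 0 := by
    intro h0; rw [h0, C_0] at h1; exact hT0 h1
  have := W.smul_mem (coeff 0 T)⁻¹ hT
  rw [h1, smul_eq_C_mul, ← C_mul, coeff_C, if_pos rfl, inv_mul_cancel₀ hc, C_1] at this
  exact this

end StableSpaces

section SingleSimple

variable {ι : Type*} [DecidableEq ι] {a : ℕ} {e : ι → ℕ} {A : Finset ι}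

theorem coeff_X_mul_pderiv (u : ι) (T : MvPolynomial ι ℂ) (s : ι →₀ ℕ) :
    coeff s (X u * pderiv u T) = s u * coeff s T := by
  rw [coeff_X_mul']
  by_cases hu : u ∈ s.support
  · obtain ⟨t, rfl⟩ : ∃ t, s = t + Finsupp.single u 1 := by
      refine ⟨s - Finsupp.single u 1, (tsub_add_cancel_of_le ?_).symm⟩
      rw [Finsupp.single_le_iff]
      exact Nat.one_le_iff_ne_zero.2 (Finsupp.mem_support_iff.1 hu)
    rw [if_pos hu, add_tsub_cancel_right, coeff_pderiv]
    simp [mul_comm]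
  · rw [if_neg hu, Finsupp.notMem_support_iff.1 hu]; simp

/-- The relation between the two coefficients of a solution that is linear in a variable of
weight one. -/
theorem ERel.coeff_relation {T U : MvPolynomial ι ℂ} (h : ERel a e A T U) {ρ r : ι}
    (hρ : ρ ∈ A) (hr : r ∈ A) (hne : r ≠ ρ) (heρ : e ρ = 1) (her : e r = a) (hd : vdeg ρ T ≤ 1)
    (s : ι →₀ ℕ) :
    ((a : ℂ) - s r) * coeff s (_root_.cf ρ 1 T)
      = (s r + 1) * coeff (s + Finsupp.single r 1) (_root_.cf ρ 0 T) := by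
  obtain ⟨h, h1, -⟩ := h
  have h2 := h1 ρ hρ r hr hne.symm
  rw [heρ, her] at h2
  have hz : _root_.cf ρ 1 (h ρ r) = 0 := by
    refine cf_eq_zero_of_sub_mul hne.symm (v := r) (m := 1) ?_ le_rfl
    rw [h2]
    exact vdeg_smul_sub_smul_le _ _ (vdeg_pderiv_le hd) (vdeg_pderiv_le hd)
  have e1 := congrArg (_root_.cf ρ 1) h2
  have e0 := congrArg (_root_.cf ρ 0) h2
  rw [sub_mul, map_sub, show (1 : ℕ) = 0 + 1 from rfl, cf_X_self_mul_succ, cf_X_mul hne,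
    zero_add, hz, mul_zero, sub_zero, map_sub, map_smul, map_smul, cf_pderiv_self,
    vdeg_le_iff.1 hd _ (by norm_num), smul_zero, smul_zero, zero_sub, cf_pderiv hne] at e1
  rw [sub_mul, map_sub, cf_X_self_mul_zero, cf_X_mul hne, e1, map_sub, map_smul, map_smul,
    cf_pderiv_self, cf_pderiv hne] at e0
  have e2 := congrArg (coeff s) e0
  simp only [zero_sub, Nat.cast_one, one_smul, mul_neg, neg_neg, coeff_X_mul_pderiv, coeff_sub,
    coeff_smul, coeff_pderiv, Nat.cast_zero, zero_add, smul_eq_mul] at e2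
  linear_combination -e2

theorem coeff_add_single_eq_of_sym {B : Finset ι} {T : MvPolynomial ι ℂ} (he : ∀ u ∈ B, e u = a)
    (hsym : ∀ u ∈ B, ∀ v ∈ B, e u = e v → rename (Equiv.swap u v) T = T) {s : ι →₀ ℕ}
    {u v : ι} (hu : u ∈ B) (hv : v ∈ B) (hs : s u = s v) :
    coeff (s + Finsupp.single u 1) T = coeff (s + Finsupp.single v 1) T := by
  have h := coeff_rename_mapDomain (Equiv.swap u v) (Equiv.swap u v).injective T
    (s + Finsupp.single u 1)
  rw [hsym u hu v hv ((he u hu).trans (he v hv).symm), Finsupp.mapDomain_add,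
    Finsupp.mapDomain_single, Equiv.swap_apply_left] at h
  rw [← h]
  congr 2
  ext w
  rw [← Finsupp.equivMapDomain_eq_mapDomain, Finsupp.equivMapDomain_apply, Equiv.symm_swap]
  by_cases h1 : w = u
  · subst h1; rw [Equiv.swap_apply_left, hs]
  · by_cases h2 : w = v
    · subst h2; rw [Equiv.swap_apply_right, hs]
    · rw [Equiv.swap_apply_of_ne_of_ne h1 h2]

/-- A homogeneous solution of the critical degree that is at most linear in the variable of weight
one vanishes. -/
theorem IsSol.eq_zero_of_linear {T : MvPolynomial ι ℂ} (h : IsSol a e A T) {ρ : ι} (hρ : ρ ∈ A)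
    (heρ : e ρ = 1) (hB : ∀ u ∈ A.erase ρ, e u = a) (hd : vdeg ρ T ≤ 1)
    (hT : T.IsHomogeneous (a * (A.erase ρ).card + 2)) : T = 0 := by
  set B := A.erase ρ with hBdef
  have hsol : IsSol a e B (_root_.cf ρ 1 T) := h.cf hρ hd
  have hhom : (_root_.cf ρ 1 T).IsHomogeneous (a * B.card + 1) := isHomogeneous_cf hT ρ 1
  have hrel : ∀ r ∈ B, ∀ s, ((a : ℂ) - s r) * coeff s (_root_.cf ρ 1 T)
      = (s r + 1) * coeff (s + Finsupp.single r 1) (_root_.cf ρ 0 T) := fun r hr s =>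
    h.second.coeff_relation hρ (Finset.mem_of_mem_erase hr) (Finset.ne_of_mem_erase hr) heρ
      (hB r hr) hd s
  set C := _root_.cf ρ 1 T
  set Φ := _root_.cf ρ 0 T
  have hvanish : ∀ k, ∀ c ∈ B, ∀ s : ι →₀ ℕ, (∀ v, v ∉ B → s v = 0) → s.degree = a * B.card →
      s c = a + k → coeff (s + Finsupp.single c 1) C = 0 := by
    intro k
    induction k with
    | zero =>
      intro c hc s hs hdeg hsc
      by_cases hall : ∀ v ∈ B, s v = a
      · have hl := congrArg (coeff s) hsol.low
        rw [fop_apply, coeff_sum, coeff_zero, Finset.sum_congr rfl (g := fun _ =>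
          coeff (s + Finsupp.single c 1) C * (a + 1)) (fun v hv => by
            rw [coeff_pderiv, hall v hv, coeff_add_single_eq_of_sym hB hsol.sym hc hv
              ((hall c hc).trans (hall v hv).symm)]), Finset.sum_const, nsmul_eq_mul] at hl
        have hBc : (B.card : ℂ) ≠ 0 := by exact_mod_cast (Finset.card_pos.2 ⟨c, hc⟩).ne'
        have ha1 : (a : ℂ) + 1 ≠ 0 := Nat.cast_add_one_ne_zero a
        simpa [hBc, ha1] using hl
      · push Not at hall
        obtain ⟨v, hv, hva⟩ := hall
        have hvc : v ≠ c := by rintro rfl; omega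
        have h1 := hrel v hv (s + Finsupp.single c 1)
        have h2 := hrel c hc (s + Finsupp.single v 1)
        rw [add_right_comm] at h2
        have h3 : (s + Finsupp.single v 1 : ι →₀ ℕ) c = a := by simp [hsc, hvc.symm]
        have h4 : (s + Finsupp.single c 1 : ι →₀ ℕ) v = s v := by simp [hvc]
        rw [h3, sub_self, zero_mul] at h2
        have ha1 : (a : ℂ) + 1 ≠ 0 := Nat.cast_add_one_ne_zero a
        rw [(mul_eq_zero.1 h2.symm).resolve_left ha1, mul_zero, h4] at h1
        refine (mul_eq_zero.1 h1).resolve_left (sub_ne_zero.2 ?_)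
        exact_mod_cast hva.symm
    | succ k ih =>
      intro c hc s hs hdeg hsc
      obtain ⟨v, hv, hvc, hva⟩ : ∃ v ∈ B, v ≠ c ∧ s v ≠ a := by
        by_contra! hcon
        rw [degree_eq_sum_of_subset hs, ← Finset.add_sum_erase B _ hc, Finset.sum_congr rfl
          (g := fun _ => a) (fun v hv => hcon v (Finset.mem_of_mem_erase hv)
            (Finset.ne_of_mem_erase hv)), Finset.sum_const, hsc, smul_eq_mul,
          Finset.card_erase_of_mem hc] at hdeg
        have hpos := Finset.card_pos.2 ⟨c, hc⟩
        obtain ⟨n, hn⟩ := Nat.exists_eq_succ_of_ne_zero hpos.ne'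
        rw [hn, Nat.succ_sub_one, Nat.succ_eq_add_one, mul_add, mul_comm] at hdeg
        omega
      have h1 := hrel v hv (s + Finsupp.single c 1)
      have h2 := hrel c hc (s + Finsupp.single v 1)
      rw [add_right_comm] at h2
      have hle : Finsupp.single c 1 ≤ s := by
        rw [Finsupp.single_le_iff]; omega
      obtain ⟨t, rfl⟩ := exists_add_of_le hle
      have h3 : coeff (Finsupp.single c 1 + t + Finsupp.single v 1) C = 0 := by
        have := ih c hc (t + Finsupp.single v 1) ?_ ?_ ?_
        · rw [← this]; congr 1; abel
        · intro w hw
          have hwv : w ≠ v := by rintro rfl; exact hw hv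
          have := hs w hw
          rw [Finsupp.add_apply] at this
          simp [hwv]
          omega
        · rw [← hdeg, map_add, map_add, Finsupp.degree_single, Finsupp.degree_single, add_comm]
        · simp only [Finsupp.add_apply, Finsupp.single_eq_same] at hsc
          simp [hvc.symm]
          omega
      rw [h3, mul_zero] at h2
      have hne : (((Finsupp.single c 1 + t + Finsupp.single v 1 : ι →₀ ℕ) c : ℕ) : ℂ) + 1 ≠ 0 :=
        Nat.cast_add_one_ne_zero _
      rw [(mul_eq_zero.1 h2.symm).resolve_left hne, mul_zero] at h1
      refine (mul_eq_zero.1 h1).resolve_left (sub_ne_zero.2 ?_)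
      have h4 : (Finsupp.single c 1 + t + Finsupp.single c 1 : ι →₀ ℕ) v =
          (Finsupp.single c 1 + t : ι →₀ ℕ) v := by
        simp [hvc]
      rw [h4]
      exact_mod_cast hva.symm
  have hC : C = 0 := by
    ext s
    rw [coeff_zero]
    by_contra hs
    have hsB := hsol.supp s hs
    have hdeg := degree_eq_of_coeff_ne_zero hhom hs
    obtain ⟨c, hc, hlt⟩ : ∃ c ∈ B, a < s c := by
      by_contra! hcon
      have := Finset.sum_le_card_nsmul B (fun v => s v) a hcon
      rw [← degree_eq_sum_of_subset hsB, hdeg, smul_eq_mul, mul_comm] at this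
      omega
    have hle : Finsupp.single c 1 ≤ s := by
      rw [Finsupp.single_le_iff]; omega
    obtain ⟨t, rfl⟩ := exists_add_of_le hle
    rw [add_comm] at hs
    refine hs (hvanish (t c - a) c hc t (fun v hv => ?_) ?_ ?_)
    · have := hsB v hv
      rw [Finsupp.add_apply] at this; omega
    · rw [map_add, Finsupp.degree_single] at hdeg; omega
    · simp only [Finsupp.add_apply, Finsupp.single_eq_same] at hlt; omega
  have hd0 : vdeg ρ T ≤ 0 := by
    rw [vdeg_le_iff] at hd ⊢
    intro k hk
    rcases Nat.lt_or_ge 1 k with h1 | h1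
    · exact hd k h1
    · obtain rfl : k = 1 := by omega
      exact hC
  by_contra hT0
  obtain ⟨s, hs⟩ := ne_zero_iff.1 hT0
  have hsd := degree_eq_of_coeff_ne_zero hT hs
  have hsρ : s ρ = 0 := by
    have := le_vdeg_of_coeff_ne_zero ρ hs
    omega
  have hsA := h.supp s hs
  obtain ⟨r, hr, hsr⟩ : ∃ r ∈ A, s r ≠ 0 := by
    by_contra! hcon
    rw [degree_eq_sum_of_subset hsA, Finset.sum_eq_zero hcon] at hsd
    omega
  have hrρ : r ≠ ρ := by rintro rfl; exact hsr hsρ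
  obtain ⟨t, rfl⟩ := exists_add_of_le (Finsupp.single_le_iff.2 (Nat.one_le_iff_ne_zero.2 hsr))
  have := hrel r (Finset.mem_erase.2 ⟨hrρ, hr⟩) t
  rw [hC, coeff_zero, mul_zero, coeff_cf, if_pos (by simp [hrρ.symm]; simpa [hrρ.symm] using hsρ),
    Finsupp.single_zero, add_zero, add_comm t] at this
  have hne : ((t r : ℕ) : ℂ) + 1 ≠ 0 := Nat.cast_add_one_ne_zero _
  exact (mul_ne_zero hne hs) this.symm

end SingleSimple

section DegreeBounds

variable {ι : Type*} [DecidableEq ι] {a : ℕ} {e : ι → ℕ}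

theorem Stable.one_mem_of_single (ha : 2 ≤ a) {A : Finset ι}
    {W : Submodule ℂ (MvPolynomial ι ℂ)} (h : Stable a e A W) (hW : W ≠ ⊥) {ρ : ι} (hρ : ρ ∈ A)
    (heρ : e ρ = 1) (hA : ∀ u ∈ A.erase ρ, e u = a) : 1 ∈ W := by
  have hsum : ∀ A : Finset ι, ρ ∈ A → (∀ u ∈ A.erase ρ, e u = a) →
      ∑ v ∈ A, e v = a * (A.erase ρ).card + 1 := by
    intro A hρ hA
    rw [← Finset.add_sum_erase A e hρ, heρ, Finset.sum_congr rfl hA, Finset.sum_const,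
      smul_eq_mul, mul_comm, add_comm]
  induction hn : (A.erase ρ).card generalizing A W with
  | zero =>
    obtain ⟨T, hT, hT0, hmin⟩ := exists_min_vdeg ρ hW
    have hstab := h.peel hρ (vdeg ρ T)
    rw [Finset.card_eq_zero.1 hn] at hstab
    rcases h.one_mem_or hρ (by omega) hmin
      (one_mem_of_supp_empty hstab.supp (peel_ne_bot hT hT0)) with h1 | ⟨k, -, hk⟩
    · exact h1
    · rw [hsum A hρ hA, hn, heρ, mul_zero, zero_add, mul_one] at hk
      have := Nat.eq_one_of_mul_eq_one_right hk
      omega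
  | succ n ih =>
    obtain ⟨r, hr⟩ := Finset.card_pos.1 (by omega : 0 < (A.erase ρ).card)
    have hrA := Finset.mem_of_mem_erase hr
    have hrρ := Finset.ne_of_mem_erase hr
    obtain ⟨T0, hT0, hT00, hmin⟩ := exists_min_vdeg r hW
    have h1 : 1 ∈ _root_.peel r (vdeg r T0) W := by
      refine ih (h.peel hrA _) (peel_ne_bot hT0 hT00) (Finset.mem_erase.2 ⟨hrρ.symm, hρ⟩) ?_ ?_
      · intro u hu
        exact hA u (Finset.erase_subset_erase _ (Finset.erase_subset _ _) hu)
      · rw [Finset.erase_right_comm, Finset.card_erase_of_mem hr, hn]; rfl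
    obtain ⟨T, hT, hsol, hd, hc⟩ := h.exists_isSol hrA hmin h1
    rcases Nat.eq_zero_or_pos (vdeg r T0) with hm | hm
    · rw [hm] at hd hc
      rw [← C_1] at hc ⊢
      rw [← eq_C_of_vdeg_zero hd hc]; exact hT
    exfalso
    obtain ⟨k, hk⟩ := Nat.exists_eq_succ_of_ne_zero hm.ne'
    rw [hk] at hc
    have hidx := hsol.second.index_eq hsol.low hrA (by rw [hA r hr]; omega)
      (m := k) (by rw [hc]; simp)
    rw [hA r hr, hsum A hρ hA] at hidx
    have hkn := Nat.eq_of_mul_eq_mul_left (by omega) hidx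
    set S := MvPolynomial.homogeneousComponent (k + 1) T with hS
    have hSsol : IsSol a e A S := hsol.homogeneousComponent k
    have hShom : S.IsHomogeneous (k + 1) := homogeneousComponent_isHomogeneous _ _
    have hS0 : S ≠ 0 := by
      refine ne_zero_iff.2 ⟨Finsupp.single r (k + 1), ?_⟩
      rw [hS, coeff_homogeneousComponent, if_pos (Finsupp.degree_single _ _)]
      have := congrArg (coeff 0) hc
      rw [coeff_cf, Finsupp.zero_apply, if_pos rfl, zero_add, coeff_one, if_pos rfl] at this
      rw [this]; exact one_ne_zero
    refine hS0 (hSsol.eq_zero_of_linear hρ heρ hA ?_ (by rw [hkn] at hShom; exact hShom))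
    have ht := cf_vdeg_ne_zero ρ hS0
    have htsol := hSsol.cf hρ le_rfl
    have hthom := isHomogeneous_cf hShom ρ (vdeg ρ S)
    by_cases hδ : k + 1 - vdeg ρ S = 0
    · exfalso
      obtain ⟨s, hs⟩ := ne_zero_iff.1 ht
      have hs0 : s = 0 := (Finsupp.degree_eq_zero_iff s).1
        (by rw [degree_eq_of_coeff_ne_zero hthom hs, hδ])
      obtain ⟨j, hj⟩ := Nat.exists_eq_succ_of_ne_zero (by omega : vdeg ρ S ≠ 0)
      have hle : vdeg ρ S ≤ k + 1 := by
        rw [coeff_cf] at hs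
        have hs' : coeff (s + Finsupp.single ρ (vdeg ρ S)) S ≠ 0 := by
          intro h0; rw [h0, ite_self] at hs; exact hs rfl
        have := degree_eq_of_coeff_ne_zero hShom hs'
        rw [degree_add_single] at this
        omega
      rw [hs0, hj] at hs
      have hidx2 := hSsol.second.index_eq hSsol.low hρ (by omega) hs
      rw [heρ, one_mul, hsum A hρ hA, ← hkn, show j = k by omega] at hidx2
      have hkpos : 0 < k := by rw [hkn]; omega
      have := Nat.eq_of_mul_eq_mul_right hkpos (hidx2.trans (one_mul k).symm)
      omega
    · have := htsol.degree_ge (by omega) hA ht hthom hδ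
      omega

theorem sum_weights_eq {σ : Type*} {e : σ → ℕ} {A : Finset σ} (hA : ∀ u ∈ A, e u = 1 ∨ e u = a) :
    ∑ v ∈ A, e v = (A.filter (e · = 1)).card + a * (A.filter (e · ≠ 1)).card := by
  rw [← Finset.sum_filter_add_sum_filter_not A (e · = 1)]
  congr 1
  · rw [Finset.card_eq_sum_ones]
    exact Finset.sum_congr rfl fun v hv => (Finset.mem_filter.1 hv).2
  · rw [Finset.sum_congr rfl (g := fun _ => a), Finset.sum_const, smul_eq_mul, mul_comm]
    intro v hv
    exact (hA v (Finset.mem_filter.1 hv).1).resolve_left (Finset.mem_filter.1 hv).2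

theorem card_filter_erase {A : Finset ι} {ρ : ι} (hρ : ρ ∈ A) (heρ : e ρ = 1) :
    ((A.erase ρ).filter (e · = 1)).card = (A.filter (e · = 1)).card - 1 ∧
      ((A.erase ρ).filter (e · ≠ 1)).card = (A.filter (e · ≠ 1)).card := by
  constructor
  · rw [Finset.filter_erase, Finset.card_erase_of_mem (Finset.mem_filter.2 ⟨hρ, heρ⟩)]
  · rw [Finset.filter_erase, Finset.erase_eq_of_notMem]
    simp [heρ]

theorem Stable.one_mem_of_lt (ha : 2 ≤ a) {A : Finset ι} {W : Submodule ℂ (MvPolynomial ι ℂ)}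
    (h : Stable a e A W) (hW : W ≠ ⊥) (hA : ∀ u ∈ A, e u = 1 ∨ e u = a)
    (h1 : 1 ≤ (A.filter (e · = 1)).card) (h2 : (A.filter (e · = 1)).card < a) : 1 ∈ W := by
  induction hj : (A.filter (e · = 1)).card generalizing A W with
  | zero => omega
  | succ j ih =>
    obtain ⟨ρ, hρ⟩ := Finset.card_pos.1 h1
    obtain ⟨hρA, heρ⟩ := Finset.mem_filter.1 hρ
    have hcard := card_filter_erase hρA heρ
    have hA' : ∀ u ∈ A.erase ρ, e u = 1 ∨ e u = a := fun u hu => hA u (Finset.mem_of_mem_erase hu)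
    rcases Nat.eq_zero_or_pos j with hj0 | hj0
    · refine h.one_mem_of_single ha hW hρA heρ fun u hu => (hA' u hu).resolve_left fun hu1 => ?_
      have : u ∈ (A.erase ρ).filter (e · = 1) := Finset.mem_filter.2 ⟨hu, hu1⟩
      have := Finset.card_pos.2 ⟨u, this⟩
      omega
    · obtain ⟨T, hT, hT0, hmin⟩ := exists_min_vdeg ρ hW
      have hp := ih (h.peel hρA _) (peel_ne_bot hT hT0) hA' (by omega) (by omega) (by omega)
      refine (h.one_mem_or hρA (by omega) hmin hp).resolve_right ?_
      rintro ⟨k, -, hk⟩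
      rw [heρ, one_mul, sum_weights_eq hA] at hk
      have hdvd : a ∣ (A.filter (e · = 1)).card :=
        (Nat.dvd_add_left (Dvd.intro _ rfl)).1 (hk ▸ Dvd.intro _ rfl)
      exact absurd (Nat.le_of_dvd h1 hdvd) (not_le.2 h2)

theorem Stable.one_notMem {A : Finset ι} {W : Submodule ℂ (MvPolynomial ι ℂ)}
    (ha : 1 ≤ a) (h : Stable a e A W) (hj : a ≤ (A.filter (e · = 1)).card) : 1 ∉ W := by
  intro h1
  obtain ⟨S, hS, hcard⟩ := Finset.exists_subset_card_eq hj
  obtain ⟨c, hc⟩ := Finset.card_pos.1 (by omega : 0 < S.card)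
  have := h.van S (hS.trans (Finset.filter_subset _ _))
    (fun v hv => (Finset.mem_filter.1 (hS hv)).2) hcard c hc 1 h1
  rw [map_one] at this
  exact one_ne_zero this

theorem vdeg_cf_le (u v : ι) (k : ℕ) (T : MvPolynomial ι ℂ) : vdeg v (cf u k T) ≤ vdeg v T := by
  by_cases h0 : cf u k T = 0
  · rw [h0, vdeg, map_zero, Polynomial.natDegree_zero]; exact Nat.zero_le _
  · obtain ⟨s, hs⟩ := ne_zero_iff.1 (cf_vdeg_ne_zero v h0)
    rw [coeff_cf, coeff_cf] at hs
    have hs' : coeff (s + Finsupp.single v (vdeg v (cf u k T)) + Finsupp.single u k) T ≠ 0 := by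
      intro h1; rw [h1] at hs; simp at hs
    have := le_vdeg_of_coeff_ne_zero v hs'
    simp only [Finsupp.add_apply, Finsupp.single_eq_same] at this
    omega

theorem mapDomain_merge_apply {S : Finset ι} {c : ι} (hc : c ∈ S) {w : ι} (hw : w ∉ S)
    (s : ι →₀ ℕ) : Finsupp.mapDomain (fun v => if v ∈ S then c else v) s w = s w := by
  have hiff : ∀ v, (if v ∈ S then c else v) = w ↔ v = w := by
    intro v
    split_ifs with hv
    · constructor
      · rintro rfl; exact absurd hc hw
      · rintro rfl; exact absurd hv hw
    · rfl
  rw [Finsupp.mapDomain, Finsupp.sum_apply, Finsupp.sum]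
  simp only [Finsupp.single_apply, hiff]
  rw [Finset.sum_ite_eq']
  split_ifs with h
  · rfl
  · exact (Finsupp.notMem_support_iff.1 h).symm

/-- If `T` vanishes when the variables of `S` are identified and has degree at most `m` in each of
them, then the coefficients of the monomials of degree exactly `m` in each of them are zero. -/
theorem coeff_eq_zero_of_rename_merge {S : Finset ι} {c : ι} (hc : c ∈ S) {T : MvPolynomial ι ℂ}
    (hT : rename (fun v => if v ∈ S then c else v) T = 0) {m : ℕ} (hd : ∀ v ∈ S, vdeg v T ≤ m)
    {s : ι →₀ ℕ} (hs : ∀ v ∈ S, s v = m) : coeff s T = 0 := by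
  by_contra hne
  set f := fun v => if v ∈ S then c else v
  have h1 : coeff (Finsupp.mapDomain f s) (rename f T) = coeff s T := by
    conv_lhs => rw [T.as_sum, map_sum, coeff_sum]
    rw [Finset.sum_eq_single s]
    · rw [rename_monomial, coeff_monomial, if_pos rfl]
    · intro t ht hts
      rw [rename_monomial, coeff_monomial, if_neg]
      intro hmap
      refine hts ?_
      have hle : t ≤ s := by
        intro w
        by_cases hw : w ∈ S
        · rw [hs w hw]
          exact (le_vdeg_of_coeff_ne_zero w (mem_support_iff.1 ht)).trans (hd w hw)
        · have := DFunLike.congr_fun hmap w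
          rw [mapDomain_merge_apply hc hw, mapDomain_merge_apply hc hw] at this
          exact this.le
      have hdeg := congrArg Finsupp.degree hmap
      rw [Finsupp.degree_mapDomain, Finsupp.degree_mapDomain] at hdeg
      obtain ⟨q, rfl⟩ := exists_add_of_le hle
      rw [map_add] at hdeg
      rw [(Finsupp.degree_eq_zero_iff q).1 (by omega), add_zero]
    · intro h0
      rw [notMem_support_iff.1 h0]; simp
  rw [hT, coeff_zero] at h1
  exact hne h1.symm

end DegreeBounds

section MainBound

variable {ι : Type*} [DecidableEq ι] {a : ℕ} {e : ι → ℕ}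

/-- The main lower bound for the degree in a variable of weight one. -/
theorem Stable.vdeg_ge (ha : 2 ≤ a) {A : Finset ι} {W : Submodule ℂ (MvPolynomial ι ℂ)}
    (h : Stable a e A W) (hA : ∀ u ∈ A, e u = 1 ∨ e u = a)
    (hj : a ≤ (A.filter (e · = 1)).card) {ρ : ι} (hρ : ρ ∈ A) (heρ : e ρ = 1)
    {T : MvPolynomial ι ℂ} (hT : T ∈ W) (hT0 : T ≠ 0) :
    (A.filter (e · ≠ 1)).card + 1 + (A.filter (e · = 1)).card / a ≤ vdeg ρ T := by
  induction hn : (A.filter (e · = 1)).card using Nat.strong_induction_on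
    generalizing A W ρ T with
  | _ j ih =>
  rw [hn] at hj
  set i := (A.filter (e · ≠ 1)).card with hi
  have hWne : W ≠ ⊥ := (Submodule.ne_bot_iff _).2 ⟨T, hT, hT0⟩
  obtain ⟨T0, hT0W, hT00, hmin⟩ := exists_min_vdeg ρ hWne
  refine le_trans ?_ (hmin T hT hT0)
  clear hT hT0 T
  set m := vdeg ρ T0 with hm
  have hdeg : ∀ v ∈ A, e v = 1 → vdeg v T0 = m := fun v hv hev =>
    vdeg_eq_of_sym (h.sym T0 hT0W) hρ hv (heρ.trans hev.symm)
  have hcard := card_filter_erase hρ heρ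
  have hA' : ∀ u ∈ A.erase ρ, e u = 1 ∨ e u = a := fun u hu => hA u (Finset.mem_of_mem_erase hu)
  have hpeel := h.peel hρ m
  have hmem : cf ρ m T0 ∈ _root_.peel ρ m W := mem_peel.2 ⟨T0, hT0W, le_rfl, rfl⟩
  have hne0 := cf_vdeg_ne_zero ρ hT00
  by_cases hdvd : a ∣ j
  swap
  · have hlt : a < j := lt_of_le_of_ne hj (by rintro rfl; exact hdvd dvd_rfl)
    obtain ⟨ρ', hρ'⟩ := Finset.card_pos.1 (by omega : 0 < ((A.erase ρ).filter (e · = 1)).card)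
    obtain ⟨hρ'A, heρ'⟩ := Finset.mem_filter.1 hρ'
    have := ih (j - 1) (by omega) hpeel hA' (by omega) hρ'A heρ' hmem hne0 (by omega)
    rw [hcard.2] at this
    have h2 := vdeg_cf_le ρ ρ' m T0
    rw [hdeg ρ' (Finset.mem_of_mem_erase hρ'A) heρ'] at h2
    have h3 : (j - 1) / a = j / a := by
      obtain ⟨q, rfl⟩ : ∃ q, j = q + 1 := ⟨j - 1, by omega⟩
      rw [Nat.succ_div_of_not_dvd hdvd, Nat.add_sub_cancel]
    omega
  obtain ⟨q, rfl⟩ := hdvd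
  rw [Nat.mul_div_cancel_left q (by omega)]
  rcases Nat.lt_or_ge q 2 with hq | hq
  · have hq1 : q = 1 := by
      interval_cases q
      · omega
      · rfl
    subst hq1
    have h1 := hpeel.one_mem_of_lt ha (peel_ne_bot hT0W hT00) hA' (by omega) (by omega)
    obtain ⟨k, hk, hidx⟩ := (h.one_mem_or hρ (by omega) hmin h1).resolve_left
      (h.one_notMem (by omega) (by omega))
    rw [heρ, one_mul, sum_weights_eq hA, hn, ← mul_add] at hidx
    have := Nat.eq_of_mul_eq_mul_left (by omega) hidx
    omega
  · by_contra hlt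
    have key : ∀ n, n ≤ a → ∀ S ⊆ A.filter (e · = 1), S.card = n →
        ∃ W', Stable a e (A \ S) W' ∧ ∃ T' ∈ W', T' ≠ 0 ∧ (∀ v, vdeg v T' ≤ vdeg v T0) ∧
          (n < a → ∀ v ∈ A \ S, e v = 1 → vdeg v T' = m) ∧
          ∀ s : ι →₀ ℕ, coeff s T' ≠ 0 →
            ∃ t : ι →₀ ℕ, coeff t T0 ≠ 0 ∧ (∀ v ∈ S, t v = m) ∧ ∀ v ∉ S, t v = s v := by
      intro n
      induction n with
      | zero =>
        intro _ S _ hS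
        obtain rfl := Finset.card_eq_zero.1 hS
        refine ⟨W, by rwa [Finset.sdiff_empty], T0, hT0W, hT00, fun _ => le_rfl,
          fun _ v hv => hdeg v (Finset.mem_sdiff.1 hv).1, fun s hs => ⟨s, hs, by simp⟩⟩
      | succ n ihn =>
        intro hna S hSA hS
        obtain ⟨v, hv⟩ := Finset.card_pos.1 (by omega : 0 < S.card)
        obtain ⟨hvA, hev⟩ := Finset.mem_filter.1 (hSA hv)
        obtain ⟨W', hW', T', hT', hT'0, hle, heq, hco⟩ := ihn (by omega) (S.erase v)
          ((Finset.erase_subset _ _).trans hSA)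
          (by rw [Finset.card_erase_of_mem hv, hS, Nat.add_sub_cancel])
        have hvm : v ∈ A \ S.erase v := by simp [hvA]
        have hvd : vdeg v T' = m := heq (by omega) v hvm hev
        have hAS : (A \ S.erase v).erase v = A \ S := by
          ext w
          simp only [Finset.mem_erase, Finset.mem_sdiff]
          constructor
          · rintro ⟨h1, h2, h3⟩; exact ⟨h2, fun h4 => h3 ⟨h1, h4⟩⟩
          · rintro ⟨h1, h2⟩; exact ⟨by rintro rfl; exact h2 hv, h1, fun h3 => h2 h3.2⟩
        have hst := hW'.peel hvm m
        rw [hAS] at hst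
        have hmem' : cf v m T' ∈ _root_.peel v m W' := mem_peel.2 ⟨T', hT', hvd.le, rfl⟩
        have hne' : cf v m T' ≠ 0 := by
          have := cf_vdeg_ne_zero v hT'0
          rwa [hvd] at this
        have hle' : ∀ w, vdeg w (cf v m T') ≤ vdeg w T0 := fun w =>
          (vdeg_cf_le v w m T').trans (hle w)
        refine ⟨_, hst, _, hmem', hne', hle', ?_, ?_⟩
        · intro hlt' w hw hew
          have hwA := (Finset.mem_sdiff.1 hw).1
          refine le_antisymm ((hle' w).trans (hdeg w hwA hew).le) ?_
          have hf1 : ((A \ S).filter (e · = 1)).card = a * q - (n + 1) := by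
            rw [← hS, ← hn, ← Finset.card_sdiff_of_subset hSA]
            congr 1
            ext w
            simp only [Finset.mem_filter, Finset.mem_sdiff]
            tauto
          have hf2 : ((A \ S).filter (e · ≠ 1)).card = i := by
            rw [hi]
            congr 1
            ext w
            simp only [Finset.mem_filter, Finset.mem_sdiff]
            constructor
            · rintro ⟨⟨h1, _⟩, h3⟩; exact ⟨h1, h3⟩
            · rintro ⟨h1, h3⟩
              exact ⟨⟨h1, fun h2 => h3 (Finset.mem_filter.1 (hSA h2)).2⟩, h3⟩
          have h2a : a * 2 ≤ a * q := Nat.mul_le_mul_left a hq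
          have := ih (a * q - (n + 1)) (by omega) hst
            (fun u hu => hA u (Finset.mem_sdiff.1 hu).1) (by omega) hw hew hmem' hne' hf1
          rw [hf2] at this
          have hdiv : q - 1 ≤ (a * q - (n + 1)) / a := by
            rw [Nat.le_div_iff_mul_le (by omega), Nat.sub_mul, mul_comm q a]
            omega
          omega
        · intro s hs
          rw [coeff_cf] at hs
          have hsv : s v = 0 := by
            by_contra h0
            rw [if_neg h0] at hs
            exact hs rfl
          rw [if_pos hsv] at hs
          obtain ⟨t, ht, h1, h2⟩ := hco _ hs
          refine ⟨t, ht, fun w hw => ?_, fun w hw => ?_⟩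
          · by_cases hwv : w = v
            · subst hwv
              rw [h2 w (by simp)]
              simp [hsv]
            · exact h1 w (Finset.mem_erase.2 ⟨hwv, hw⟩)
          · have hwv : w ≠ v := by rintro rfl; exact hw hv
            rw [h2 w (fun h3 => hw (Finset.mem_of_mem_erase h3))]
            simp [Finsupp.single_eq_of_ne hwv]
    obtain ⟨S, hSA, hS⟩ := Finset.exists_subset_card_eq (hj.trans hn.ge)
    obtain ⟨W', -, T', -, hT'0, -, -, hco⟩ := key a le_rfl S hSA hS
    obtain ⟨s, hs⟩ := ne_zero_iff.1 hT'0
    obtain ⟨t, ht, h1, -⟩ := hco s hs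
    obtain ⟨c, hc⟩ := Finset.card_pos.1 (by omega : 0 < S.card)
    have hSA' := fun v (hv : v ∈ S) => Finset.mem_filter.1 (hSA hv)
    exact ht (coeff_eq_zero_of_rename_merge hc
      (h.van S (fun v hv => (hSA' v hv).1) (fun v hv => (hSA' v hv).2) hS c hc T0 hT0W)
      (fun v hv => (hdeg v (hSA' v hv).1 (hSA' v hv).2).le) h1)

end MainBound

section RootForms

/-- The evaluation `z_l ↦` coefficient of `x ^ l` in `F`. -/
noncomputable def coeffHom {A : Type*} [CommRing A] [Algebra ℂ A] (F : Polynomial A) :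
    MvPolynomial ℕ ℂ →ₐ[ℂ] A :=
  aeval F.coeff

theorem coeffHom_X {A : Type*} [CommRing A] [Algebra ℂ A] (F : Polynomial A) (l : ℕ) :
    coeffHom F (X l) = F.coeff l :=
  aeval_X _ _

theorem map_coeffHom {A B : Type*} [CommRing A] [Algebra ℂ A] [CommRing B] [Algebra ℂ B]
    (φ : A →ₐ[ℂ] B) (F : Polynomial A) (P : MvPolynomial ℕ ℂ) :
    φ (coeffHom F P) = coeffHom (F.map φ.toRingHom) P := by
  have : φ.comp (coeffHom F) = coeffHom (F.map φ.toRingHom) := by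
    ext l
    simp [coeffHom]
  exact DFunLike.congr_fun this P

section Products

variable {ι A : Type*} [DecidableEq ι] [CommRing A]

/-- `∏_{u ∈ s} (x - y_u) ^ {e_u}`. -/
noncomputable def rootProd (y : ι → A) (e : ι → ℕ) (s : Finset ι) : Polynomial A :=
  ∏ u ∈ s, (Polynomial.X - Polynomial.C (y u)) ^ e u

/-- `rootProd` with one factor `x - y_u` removed. -/
noncomputable def rootProd₁ (y : ι → A) (e : ι → ℕ) (s : Finset ι) (u : ι) : Polynomial A :=
  (Polynomial.X - Polynomial.C (y u)) ^ (e u - 1) * rootProd y e (s.erase u)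

/-- `rootProd` with two factors `x - y_u` removed. -/
noncomputable def rootProd₂ (y : ι → A) (e : ι → ℕ) (s : Finset ι) (u : ι) : Polynomial A :=
  (Polynomial.X - Polynomial.C (y u)) ^ (e u - 2) * rootProd y e (s.erase u)

/-- `rootProd` with the factors `x - y_u` and `x - y_v` removed. -/
noncomputable def rootProd₁₁ (y : ι → A) (e : ι → ℕ) (s : Finset ι) (u v : ι) : Polynomial A :=
  (Polynomial.X - Polynomial.C (y u)) ^ (e u - 1) *
    ((Polynomial.X - Polynomial.C (y v)) ^ (e v - 1) * rootProd y e ((s.erase u).erase v))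

variable (y : ι → A) (e : ι → ℕ) {s : Finset ι} {u v : ι}

theorem mul_rootProd_erase (hu : u ∈ s) :
    (Polynomial.X - Polynomial.C (y u)) ^ e u * rootProd y e (s.erase u) = rootProd y e s :=
  Finset.mul_prod_erase s _ hu

theorem sub_mul_rootProd₁ (hu : u ∈ s) (he : 1 ≤ e u) :
    (Polynomial.X - Polynomial.C (y u)) * rootProd₁ y e s u = rootProd y e s := by
  rw [rootProd₁, ← mul_assoc, ← pow_succ', Nat.sub_add_cancel he, mul_rootProd_erase y e hu]

theorem sub_mul_rootProd₂ (he : 2 ≤ e u) :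
    (Polynomial.X - Polynomial.C (y u)) * rootProd₂ y e s u = rootProd₁ y e s u := by
  rw [rootProd₁, rootProd₂, ← mul_assoc, ← pow_succ']
  congr 2
  omega

theorem rootProd₁_eq (hv : v ∈ s) (huv : v ≠ u) (he : 1 ≤ e v) :
    rootProd₁ y e s u = (Polynomial.X - Polynomial.C (y v)) * rootProd₁₁ y e s u v := by
  rw [rootProd₁, rootProd₁₁, mul_left_comm, ← mul_assoc (Polynomial.X - Polynomial.C (y v)),
    ← pow_succ', Nat.sub_add_cancel he, mul_rootProd_erase y e (Finset.mem_erase.2 ⟨huv, hv⟩)]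

theorem rootProd₁₁_comm : rootProd₁₁ y e s u v = rootProd₁₁ y e s v u := by
  rw [rootProd₁₁, rootProd₁₁, mul_left_comm, Finset.erase_right_comm]

theorem derivative_rootProd :
    Polynomial.derivative (rootProd y e s) = ∑ u ∈ s, (e u : Polynomial A) * rootProd₁ y e s u := by
  rw [rootProd, Polynomial.derivative_prod_finset]
  refine Finset.sum_congr rfl fun u _ => ?_
  rw [Polynomial.derivative_X_sub_C_pow, rootProd₁, rootProd]
  simp only [map_natCast]
  ring

theorem derivative_rootProd₁ :
    Polynomial.derivative (rootProd₁ y e s u) = ((e u - 1 : ℕ) : Polynomial A) * rootProd₂ y e s u +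
      ∑ v ∈ s.erase u, (e v : Polynomial A) * rootProd₁₁ y e s u v := by
  rw [rootProd₁, Polynomial.derivative_mul, derivative_rootProd,
    Polynomial.derivative_X_sub_C_pow, rootProd₂, Finset.mul_sum]
  congr 1
  · simp only [map_natCast, Nat.sub_sub]
    ring
  · refine Finset.sum_congr rfl fun v _ => ?_
    rw [rootProd₁, rootProd₁₁]
    ring

theorem natDegree_rootProd_le {σ : Type*} (y : σ → A) (e : σ → ℕ) {s : Finset σ} :
    (rootProd y e s).natDegree ≤ ∑ u ∈ s, e u := by
  refine (Polynomial.natDegree_prod_le _ _).trans (Finset.sum_le_sum fun u _ => ?_)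
  refine Polynomial.natDegree_pow_le.trans ?_
  exact (Nat.mul_le_mul_left _ (Polynomial.natDegree_X_sub_C_le _)).trans (by omega)

theorem X_mul_derivative_derivative_rootProd (he : ∀ u ∈ s, 1 ≤ e u) :
    Polynomial.X * Polynomial.derivative (Polynomial.derivative (rootProd y e s)) =
      ∑ u ∈ s, (e u : Polynomial A) * ((e u - 1 : ℕ) : Polynomial A) *
        (rootProd₁ y e s u + Polynomial.C (y u) * rootProd₂ y e s u) +
      ∑ u ∈ s, ∑ v ∈ s.erase u, (e u : Polynomial A) * (e v : Polynomial A) *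
        (rootProd₁ y e s v + Polynomial.C (y u) * rootProd₁₁ y e s u v) := by
  rw [derivative_rootProd, Polynomial.derivative_sum, Finset.mul_sum, ← Finset.sum_add_distrib]
  refine Finset.sum_congr rfl fun u hu => ?_
  rw [Polynomial.derivative_mul, Polynomial.derivative_natCast, derivative_rootProd₁, zero_mul,
    zero_add, mul_add, mul_add]
  congr 1
  · rcases Nat.lt_or_ge (e u) 2 with h | h
    · have : e u - 1 = 0 := by omega
      simp [this]
    · rw [← sub_mul_rootProd₂ y e h]
      ring
  · rw [Finset.mul_sum, Finset.mul_sum]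
    refine Finset.sum_congr rfl fun v hv => ?_
    rw [rootProd₁_eq y e hu (Finset.mem_erase.1 hv).1.symm (he u hu), rootProd₁₁_comm y e (u := v)]
    ring

end Products

section PartialDerivatives

variable {ι : Type*}

/-- The coefficients of `G'` are the partial derivatives with respect to `u` of those of `G`. -/
def IsCoeffPderiv (u : ι) (G G' : Polynomial (MvPolynomial ι ℂ)) : Prop :=
  ∀ l, pderiv u (G.coeff l) = G'.coeff l

theorem IsCoeffPderiv.mul {u : ι} {G G' H H' : Polynomial (MvPolynomial ι ℂ)}
    (hG : IsCoeffPderiv u G G') (hH : IsCoeffPderiv u H H') :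
    IsCoeffPderiv u (G * H) (G' * H + G * H') := by
  intro l
  rw [Polynomial.coeff_mul, map_sum, Polynomial.coeff_add, Polynomial.coeff_mul,
    Polynomial.coeff_mul, ← Finset.sum_add_distrib]
  refine Finset.sum_congr rfl fun p _ => ?_
  rw [pderiv_mul, hG, hH]

theorem isCoeffPderiv_X_sub_C (u : ι) :
    IsCoeffPderiv u (Polynomial.X - Polynomial.C (X u)) (-1) := by
  intro l
  rw [Polynomial.coeff_sub, Polynomial.coeff_X, Polynomial.coeff_C, Polynomial.coeff_neg,
    Polynomial.coeff_one, map_sub]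
  split_ifs <;> simp_all

theorem isCoeffPderiv_X_sub_C_of_ne {u v : ι} (h : v ≠ u) :
    IsCoeffPderiv u (Polynomial.X - Polynomial.C (X v)) 0 := by
  intro l
  rw [Polynomial.coeff_sub, Polynomial.coeff_X, Polynomial.coeff_C, map_sub, Polynomial.coeff_zero]
  split_ifs <;> simp [pderiv_X_of_ne h]

theorem isCoeffPderiv_one (u : ι) : IsCoeffPderiv u 1 0 := by
  intro l
  rw [Polynomial.coeff_one, Polynomial.coeff_zero]
  split_ifs <;> simp

theorem IsCoeffPderiv.pow {u : ι} {G G' : Polynomial (MvPolynomial ι ℂ)}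
    (hG : IsCoeffPderiv u G G') (k : ℕ) :
    IsCoeffPderiv u (G ^ k) ((k : Polynomial (MvPolynomial ι ℂ)) * G ^ (k - 1) * G') := by
  induction k with
  | zero => simpa using isCoeffPderiv_one u
  | succ k ih =>
    rw [pow_succ]
    convert ih.mul hG using 1
    rcases k with _ | k
    · simp
    · simp only [Nat.add_sub_cancel, Nat.cast_add, Nat.cast_one]
      ring

variable [DecidableEq ι] (e : ι → ℕ) {s : Finset ι} {u v : ι}

theorem isCoeffPderiv_rootProd_of_notMem (hu : u ∉ s) :
    IsCoeffPderiv u (rootProd X e s) 0 := by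
  rw [rootProd]
  induction s using Finset.induction_on with
  | empty => rw [Finset.prod_empty]; exact isCoeffPderiv_one u
  | insert w s hw ih =>
    rw [Finset.prod_insert hw]
    have h1 : w ≠ u := by rintro rfl; exact hu (Finset.mem_insert_self _ _)
    have := ((isCoeffPderiv_X_sub_C_of_ne h1).pow (e w)).mul
      (ih fun h => hu (Finset.mem_insert_of_mem h))
    simpa using this

theorem isCoeffPderiv_rootProd (hu : u ∈ s) :
    IsCoeffPderiv u (rootProd X e s)
      (-((e u : Polynomial (MvPolynomial ι ℂ)) * rootProd₁ X e s u)) := by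
  rw [← mul_rootProd_erase X e hu]
  convert ((isCoeffPderiv_X_sub_C u).pow (e u)).mul
    (isCoeffPderiv_rootProd_of_notMem e (Finset.notMem_erase u s)) using 1
  rw [rootProd₁]
  ring

theorem isCoeffPderiv_rootProd₁ :
    IsCoeffPderiv u (rootProd₁ X e s u)
      (-(((e u - 1 : ℕ) : Polynomial (MvPolynomial ι ℂ)) * rootProd₂ X e s u)) := by
  rw [rootProd₁]
  convert ((isCoeffPderiv_X_sub_C u).pow (e u - 1)).mul
    (isCoeffPderiv_rootProd_of_notMem e (Finset.notMem_erase u s)) using 1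
  rw [rootProd₂, Nat.sub_sub]
  ring

/-- The derivative of `P` along `g`, evaluated at the coefficients of `F`. -/
noncomputable def dirDeriv (K : ℕ) (F : Polynomial (MvPolynomial ι ℂ)) (P : MvPolynomial ℕ ℂ) :
    Polynomial (MvPolynomial ι ℂ) →ₗ[MvPolynomial ι ℂ] MvPolynomial ι ℂ :=
  ∑ l ∈ Finset.range K, coeffHom F (pderiv l P) • Polynomial.lcoeff (MvPolynomial ι ℂ) l

theorem dirDeriv_apply {σ : Type*} (K : ℕ) (F : Polynomial (MvPolynomial σ ℂ))
    (P : MvPolynomial ℕ ℂ) (g : Polynomial (MvPolynomial σ ℂ)) :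
    dirDeriv K F P g = ∑ l ∈ Finset.range K, coeffHom F (pderiv l P) * g.coeff l := by
  simp [dirDeriv, LinearMap.sum_apply]

theorem pderiv_coeffHom {σ : Type*} {u : σ} {K : ℕ} {F F' : Polynomial (MvPolynomial σ ℂ)}
    (hK : F.natDegree < K) (hF : IsCoeffPderiv u F F') (P : MvPolynomial ℕ ℂ) :
    pderiv u (coeffHom F P) = dirDeriv K F P F' := by
  rw [dirDeriv_apply]
  induction P using MvPolynomial.induction_on with
  | C c => simp [coeffHom]
  | add P Q hP hQ => simp only [map_add, hP, hQ, add_mul, Finset.sum_add_distrib]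
  | mul_X P k hP =>
    have hX : pderiv u (coeffHom F (X k)) =
        ∑ l ∈ Finset.range K, coeffHom F (pderiv l (X k)) * F'.coeff l := by
      rw [coeffHom_X, hF]
      by_cases hk : k < K
      · rw [Finset.sum_eq_single k]
        · simp
        · intro l _ hlk
          rw [pderiv_X_of_ne hlk.symm, map_zero, zero_mul]
        · intro h; exact absurd (Finset.mem_range.2 hk) h
      · rw [← hF, Polynomial.coeff_eq_zero_of_natDegree_lt (by omega), map_zero, Finset.sum_eq_zero]
        intro l hl
        rw [pderiv_X_of_ne (by rintro rfl; exact hk (Finset.mem_range.1 hl)), map_zero, zero_mul]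
    rw [map_mul, pderiv_mul, hP, hX, Finset.sum_mul, Finset.mul_sum, ← Finset.sum_add_distrib]
    refine Finset.sum_congr rfl fun l _ => ?_
    rw [pderiv_mul, map_add, map_mul, map_mul]
    ring

end PartialDerivatives

end RootForms

section Operators

/-- The quadratic form in the coefficients of `F` equal to
`∑_u e_u [x ^ p] (F / (x - y_u)) [x ^ q] (F / (x - y_u))`. -/
noncomputable def bezForm : ℕ → ℕ → MvPolynomial ℕ ℂ
  | 0, q => X (q + 1) * X 1 - ((q + 2 : ℕ) : MvPolynomial ℕ ℂ) * (X 0 * X (q + 2))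
  | p + 1, q => bezForm p (q + 1) - ((q + 2 : ℕ) : MvPolynomial ℕ ℂ) * (X (p + 1) * X (q + 2)) +
      ((p + 2 : ℕ) : MvPolynomial ℕ ℂ) * (X (q + 1) * X (p + 2))

/-- The quadratic form in the coefficients of `F` equal to
`∑_u e_u y_u [x ^ p] (F / (x - y_u)) [x ^ q] (F / (x - y_u))`. -/
noncomputable def shiftBezForm : ℕ → ℕ → MvPolynomial ℕ ℂ
  | 0, q => -(((q + 1 : ℕ) : MvPolynomial ℕ ℂ) * (X 0 * X (q + 1)))
  | p + 1, q => bezForm p q - ((q + 1 : ℕ) : MvPolynomial ℕ ℂ) * (X (p + 1) * X (q + 1))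

/-- The operator corresponding to `-∑_u ∂_u` on the coefficients. -/
noncomputable def lowOp (K : ℕ) (P : MvPolynomial ℕ ℂ) : MvPolynomial ℕ ℂ :=
  ∑ l ∈ Finset.range K, ((l + 1 : ℕ) : MvPolynomial ℕ ℂ) * (X (l + 1) * pderiv l P)

/-- The second order operator on the coefficients. -/
noncomputable def secOp (a K : ℕ) (P : MvPolynomial ℕ ℂ) : MvPolynomial ℕ ℂ :=
  (∑ p ∈ Finset.range K, ∑ q ∈ Finset.range K,
    (a : MvPolynomial ℕ ℂ) * (shiftBezForm p q * pderiv q (pderiv p P))) +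
  ∑ l ∈ Finset.range K, (((l + 1) * l : ℕ) : MvPolynomial ℕ ℂ) * (X (l + 1) * pderiv l P)

section Homogeneity

theorem isHomogeneous_natCast_mul {σ : Type*} {P : MvPolynomial σ ℂ} {n : ℕ} (k : ℕ)
    (h : P.IsHomogeneous n) : ((k : MvPolynomial σ ℂ) * P).IsHomogeneous n := by
  have := (isHomogeneous_C σ (k : ℂ)).mul h
  rwa [zero_add, map_natCast] at this

theorem isHomogeneous_bezForm (p q : ℕ) : (bezForm p q).IsHomogeneous 2 := by
  have h : ∀ i j : ℕ, (X i * X j : MvPolynomial ℕ ℂ).IsHomogeneous 2 := fun i j =>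
    (isHomogeneous_X ℂ i).mul (isHomogeneous_X ℂ j)
  induction p generalizing q with
  | zero =>
    rw [bezForm]
    exact (h _ _).sub (isHomogeneous_natCast_mul _ (h _ _))
  | succ p ih =>
    rw [bezForm]
    exact ((ih _).sub (isHomogeneous_natCast_mul _ (h _ _))).add
      (isHomogeneous_natCast_mul _ (h _ _))

theorem isHomogeneous_shiftBezForm (p q : ℕ) : (shiftBezForm p q).IsHomogeneous 2 := by
  have h : ∀ i j : ℕ, (X i * X j : MvPolynomial ℕ ℂ).IsHomogeneous 2 := fun i j =>
    (isHomogeneous_X ℂ i).mul (isHomogeneous_X ℂ j)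
  cases p with
  | zero => exact (isHomogeneous_natCast_mul _ (h _ _)).neg
  | succ p => exact (isHomogeneous_bezForm _ _).sub (isHomogeneous_natCast_mul _ (h _ _))

theorem pderiv_eq_zero_of_isHomogeneous_zero {σ : Type*} {P : MvPolynomial σ ℂ}
    (h : P.IsHomogeneous 0) (l : σ) : pderiv l P = 0 := by
  rw [totalDegree_eq_zero_iff_eq_C.1 ((totalDegree_zero_iff_isHomogeneous _).2 h), pderiv_C]

theorem isHomogeneous_mul_pderiv {σ : Type*} {P Q : MvPolynomial σ ℂ} {n : ℕ}
    (h : P.IsHomogeneous n) (hQ : Q.IsHomogeneous 1) (l : σ) :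
    (Q * pderiv l P).IsHomogeneous n := by
  cases n with
  | zero =>
    rw [pderiv_eq_zero_of_isHomogeneous_zero h, mul_zero]
    exact isHomogeneous_zero _ _ _
  | succ n =>
    rw [add_comm]
    exact hQ.mul h.pderiv

theorem isHomogeneous_mul_pderiv_pderiv {σ : Type*} {P Q : MvPolynomial σ ℂ} {n : ℕ}
    (h : P.IsHomogeneous n) (hQ : Q.IsHomogeneous 2) (l k : σ) :
    (Q * pderiv l (pderiv k P)).IsHomogeneous n := by
  match n with
  | 0 =>
    rw [pderiv_eq_zero_of_isHomogeneous_zero h, map_zero, mul_zero]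
    exact isHomogeneous_zero _ _ _
  | 1 =>
    rw [pderiv_eq_zero_of_isHomogeneous_zero h.pderiv, mul_zero]
    exact isHomogeneous_zero _ _ _
  | n + 2 =>
    rw [add_comm]
    exact hQ.mul h.pderiv.pderiv

theorem isHomogeneous_lowOp {P : MvPolynomial ℕ ℂ} {n : ℕ} (h : P.IsHomogeneous n) (K : ℕ) :
    (lowOp K P).IsHomogeneous n :=
  IsHomogeneous.sum _ _ _ fun _ _ =>
    isHomogeneous_natCast_mul _ (isHomogeneous_mul_pderiv h (isHomogeneous_X _ _) _)

theorem isHomogeneous_secOp {P : MvPolynomial ℕ ℂ} {n : ℕ} (h : P.IsHomogeneous n) (a K : ℕ) :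
    (secOp a K P).IsHomogeneous n :=
  (IsHomogeneous.sum _ _ _ fun _ _ => IsHomogeneous.sum _ _ _ fun _ _ =>
    isHomogeneous_natCast_mul _
      (isHomogeneous_mul_pderiv_pderiv h (isHomogeneous_shiftBezForm _ _) _ _)).add
  (IsHomogeneous.sum _ _ _ fun _ _ =>
    isHomogeneous_natCast_mul _ (isHomogeneous_mul_pderiv h (isHomogeneous_X _ _) _))

end Homogeneity

section Quadratic

variable {ι A : Type*} [DecidableEq ι] [CommRing A] (y : ι → A) (e : ι → ℕ) {s : Finset ι}

theorem sum_coeff_rootProd₁ (q : ℕ) :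
    ∑ u ∈ s, (e u : A) * (rootProd₁ y e s u).coeff q =
      ((q + 1 : ℕ) : A) * (rootProd y e s).coeff (q + 1) := by
  have := congrArg (fun g => Polynomial.coeff g q) (derivative_rootProd y e (s := s))
  simp only [Polynomial.coeff_derivative, Polynomial.finsetSum_coeff,
    Polynomial.coeff_natCast_mul] at this
  rw [← this]
  push_cast
  ring

theorem coeff_zero_rootProd {u : ι} (hu : u ∈ s) (he : 1 ≤ e u) :
    (rootProd y e s).coeff 0 = -(y u * (rootProd₁ y e s u).coeff 0) := by
  rw [← sub_mul_rootProd₁ y e hu he, sub_mul, Polynomial.coeff_sub, Polynomial.coeff_C_mul,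
    Polynomial.coeff_X_mul_zero, zero_sub]

theorem coeff_succ_rootProd {u : ι} (hu : u ∈ s) (he : 1 ≤ e u) (p : ℕ) :
    (rootProd y e s).coeff (p + 1) =
      (rootProd₁ y e s u).coeff p - y u * (rootProd₁ y e s u).coeff (p + 1) := by
  rw [← sub_mul_rootProd₁ y e hu he, sub_mul, Polynomial.coeff_sub, Polynomial.coeff_C_mul,
    Polynomial.coeff_X_mul]

variable [Algebra ℂ A]

theorem coeffHom_bezForm (he : ∀ u ∈ s, 1 ≤ e u) (p q : ℕ) :
    coeffHom (rootProd y e s) (bezForm p q) =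
      ∑ u ∈ s, (e u : A) * ((rootProd₁ y e s u).coeff p * (rootProd₁ y e s u).coeff q) := by
  induction p generalizing q with
  | zero =>
    have h1 := sum_coeff_rootProd₁ y e (s := s) 0
    have h2 := sum_coeff_rootProd₁ y e (s := s) (q + 1)
    rw [bezForm]
    simp only [map_sub, map_mul, map_natCast, coeffHom_X]
    simp only [zero_add, Nat.cast_one, one_mul] at h1
    rw [← h1, mul_left_comm, add_assoc q 1 1, one_add_one_eq_two] at *
    rw [← h2, Finset.mul_sum, Finset.mul_sum, ← Finset.sum_sub_distrib]
    refine Finset.sum_congr rfl fun u hu => ?_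
    rw [coeff_zero_rootProd y e hu (he u hu), coeff_succ_rootProd y e hu (he u hu)]
    ring
  | succ p ih =>
    have h2 := sum_coeff_rootProd₁ y e (s := s) (q + 1)
    have h3 := sum_coeff_rootProd₁ y e (s := s) (p + 1)
    rw [bezForm]
    simp only [map_sub, map_add, map_mul, map_natCast, coeffHom_X, ih]
    rw [add_assoc q 1 1, add_assoc p 1 1, one_add_one_eq_two] at *
    rw [mul_left_comm, ← h2, mul_left_comm _ _ ((rootProd y e s).coeff (p + 2)), ← h3,
      Finset.mul_sum, Finset.mul_sum, ← Finset.sum_sub_distrib, ← Finset.sum_add_distrib]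
    refine Finset.sum_congr rfl fun u hu => ?_
    rw [coeff_succ_rootProd y e hu (he u hu), coeff_succ_rootProd y e hu (he u hu)]
    ring

theorem coeffHom_shiftBezForm (he : ∀ u ∈ s, 1 ≤ e u) (p q : ℕ) :
    coeffHom (rootProd y e s) (shiftBezForm p q) =
      ∑ u ∈ s, (e u : A) * y u *
        ((rootProd₁ y e s u).coeff p * (rootProd₁ y e s u).coeff q) := by
  have h2 := sum_coeff_rootProd₁ y e (s := s) q
  cases p with
  | zero =>
    rw [shiftBezForm]
    simp only [map_neg, map_mul, map_natCast, coeffHom_X]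
    rw [mul_left_comm, ← h2, Finset.mul_sum, ← Finset.sum_neg_distrib]
    refine Finset.sum_congr rfl fun u hu => ?_
    rw [coeff_zero_rootProd y e hu (he u hu)]
    ring
  | succ p =>
    rw [shiftBezForm]
    simp only [map_sub, map_mul, map_natCast, coeffHom_X, coeffHom_bezForm y e he]
    rw [mul_left_comm, ← h2, Finset.mul_sum, ← Finset.sum_sub_distrib]
    refine Finset.sum_congr rfl fun u hu => ?_
    rw [coeff_succ_rootProd y e hu (he u hu)]
    ring

end Quadratic

section Relation

variable {ι : Type*} [DecidableEq ι] {a K : ℕ} {e : ι → ℕ} {s : Finset ι}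

theorem dirDeriv_natCast_mul {σ : Type*} (F : Polynomial (MvPolynomial σ ℂ))
    (P : MvPolynomial ℕ ℂ) (k : ℕ) (g : Polynomial (MvPolynomial σ ℂ)) :
    dirDeriv K F P ((k : Polynomial (MvPolynomial σ ℂ)) * g) =
      (k : MvPolynomial σ ℂ) * dirDeriv K F P g := by
  rw [← nsmul_eq_mul, map_nsmul, nsmul_eq_mul]

theorem dirDeriv_C_mul {σ : Type*} (F : Polynomial (MvPolynomial σ ℂ)) (P : MvPolynomial ℕ ℂ)
    (c : MvPolynomial σ ℂ) (g : Polynomial (MvPolynomial σ ℂ)) :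
    dirDeriv K F P (Polynomial.C c * g) = c * dirDeriv K F P g := by
  rw [← Polynomial.smul_eq_C_mul, map_smul, smul_eq_mul]

theorem pderiv_coeffHom_rootProd (hK : ∑ u ∈ s, e u < K) {u : ι} (hu : u ∈ s)
    (P : MvPolynomial ℕ ℂ) :
    pderiv u (coeffHom (rootProd X e s) P) =
      -((e u : MvPolynomial ι ℂ) * dirDeriv K (rootProd X e s) P (rootProd₁ X e s u)) := by
  rw [pderiv_coeffHom ((natDegree_rootProd_le _ _).trans_lt hK) (isCoeffPderiv_rootProd e hu),
    map_neg, dirDeriv_natCast_mul]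

theorem pderiv_pderiv_coeffHom_rootProd (hK : ∑ u ∈ s, e u < K) {u : ι} (hu : u ∈ s)
    (P : MvPolynomial ℕ ℂ) :
    pderiv u (pderiv u (coeffHom (rootProd X e s) P)) =
      (e u : MvPolynomial ι ℂ) ^ 2 * ∑ p ∈ Finset.range K,
        dirDeriv K (rootProd X e s) (pderiv p P) (rootProd₁ X e s u) * (rootProd₁ X e s u).coeff p +
      (e u : MvPolynomial ι ℂ) * ((e u - 1 : ℕ) : MvPolynomial ι ℂ) *
        dirDeriv K (rootProd X e s) P (rootProd₂ X e s u) := by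
  rw [pderiv_coeffHom_rootProd hK hu, dirDeriv_apply, map_neg, pderiv_mul, map_sum,
    dirDeriv_apply]
  have h0 : pderiv u (e u : MvPolynomial ι ℂ) = 0 := by
    rw [← map_natCast C, pderiv_C]
  rw [h0, zero_mul, zero_add, Finset.mul_sum, Finset.mul_sum, Finset.mul_sum,
    ← Finset.sum_add_distrib, ← Finset.sum_neg_distrib]
  refine Finset.sum_congr rfl fun p _ => ?_
  rw [pderiv_mul, pderiv_coeffHom_rootProd hK hu, isCoeffPderiv_rootProd₁ e p,
    Polynomial.coeff_neg, Polynomial.coeff_natCast_mul]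
  ring

theorem fop_coeffHom_rootProd (hK : ∑ u ∈ s, e u < K) (P : MvPolynomial ℕ ℂ) :
    fop s (coeffHom (rootProd X e s) P) = -coeffHom (rootProd X e s) (lowOp K P) := by
  rw [fop_apply, Finset.sum_congr rfl fun u hu => pderiv_coeffHom_rootProd hK hu P,
    Finset.sum_neg_distrib]
  congr 1
  simp_rw [← dirDeriv_natCast_mul]
  rw [← map_sum, ← derivative_rootProd, dirDeriv_apply, lowOp, map_sum]
  refine Finset.sum_congr rfl fun l _ => ?_
  rw [Polynomial.coeff_derivative, map_mul, map_mul, map_natCast, coeffHom_X]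
  push_cast
  ring

theorem eRel_coeffHom_rootProd (ha : 1 ≤ a) (he : ∀ u ∈ s, e u = 1 ∨ e u = a)
    (hK : ∑ u ∈ s, e u < K) (P : MvPolynomial ℕ ℂ) :
    ERel a e s (coeffHom (rootProd X e s) P) (coeffHom (rootProd X e s) (secOp a K P)) := by
  have he1 : ∀ u ∈ s, 1 ≤ e u := fun u hu => by rcases he u hu with h | h <;> omega
  set F : Polynomial (MvPolynomial ι ℂ) := rootProd X e s with hF
  refine ⟨fun u v => -((e u : MvPolynomial ι ℂ) * (e v : MvPolynomial ι ℂ) *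
    dirDeriv K F P (rootProd₁₁ X e s u v)), ?_, ?_⟩
  · intro u hu v hv huv
    rw [pderiv_coeffHom_rootProd hK hu, pderiv_coeffHom_rootProd hK hv,
      rootProd₁_eq X e hv huv.symm (he1 v hv), rootProd₁_eq X e hu huv (he1 u hu),
      rootProd₁₁_comm X e (u := v), ← hF,
      sub_mul (Polynomial.X : Polynomial (MvPolynomial ι ℂ)),
      sub_mul (Polynomial.X : Polynomial (MvPolynomial ι ℂ)), map_sub, map_sub, dirDeriv_C_mul,
      dirDeriv_C_mul, smul_eq_C_mul, smul_eq_C_mul, map_natCast, map_natCast]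
    ring
  · have hsec : coeffHom F (secOp a K P) =
        ∑ u ∈ s, (a : MvPolynomial ι ℂ) * ((e u : MvPolynomial ι ℂ) * (X u *
          ∑ p ∈ Finset.range K,
            dirDeriv K F (pderiv p P) (rootProd₁ X e s u) * (rootProd₁ X e s u).coeff p)) +
        dirDeriv K F P (Polynomial.X * Polynomial.derivative (Polynomial.derivative F)) := by
      rw [secOp, map_add, map_sum, map_sum]
      congr 1
      · simp_rw [dirDeriv_apply, Finset.sum_mul, Finset.mul_sum]
        rw [Finset.sum_comm]
        refine Finset.sum_congr rfl fun p _ => ?_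
        rw [map_sum, Finset.sum_comm]
        refine Finset.sum_congr rfl fun q _ => ?_
        rw [map_mul, map_mul, map_natCast, coeffHom_shiftBezForm X e he1, Finset.sum_mul,
          Finset.mul_sum]
        refine Finset.sum_congr rfl fun u _ => ?_
        ring
      · rw [dirDeriv_apply]
        refine Finset.sum_congr rfl fun l _ => ?_
        rw [map_mul, map_mul, map_natCast, coeffHom_X]
        cases l with
        | zero => simp
        | succ l =>
          rw [Polynomial.coeff_X_mul, Polynomial.coeff_derivative, Polynomial.coeff_derivative]
          push_cast
          ring
    rw [hsec, hF, X_mul_derivative_derivative_rootProd X e he1, ← hF, map_add, ← add_assoc,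
      map_sum, ← Finset.sum_add_distrib, sub_eq_add_neg (∑ u ∈ s, _), ← Finset.sum_neg_distrib,
      map_sum]
    congr 1
    · refine Finset.sum_congr rfl fun u hu => ?_
      rw [pderiv_pderiv_coeffHom_rootProd hK hu, pderiv_coeffHom_rootProd hK hu, mul_assoc,
        dirDeriv_natCast_mul, dirDeriv_natCast_mul, map_add, dirDeriv_C_mul, smul_eq_C_mul,
        smul_eq_C_mul]
      rcases he u hu with h | h
      · rw [h]
        simp [hF]
      · rw [h, div_self (by exact_mod_cast (by omega : a ≠ 0)), Nat.cast_sub ha]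
        simp only [map_one, map_sub, map_natCast, Nat.cast_one]
        ring
    · refine Finset.sum_congr rfl fun u hu => ?_
      rw [map_sum, ← Finset.sum_neg_distrib]
      refine Finset.sum_congr rfl fun v hv => ?_
      rw [pderiv_coeffHom_rootProd hK (Finset.mem_of_mem_erase hv), mul_assoc,
        dirDeriv_natCast_mul, dirDeriv_natCast_mul, map_add, dirDeriv_C_mul, smul_eq_C_mul,
        map_natCast]
      ring

end Relation

end Operators

section Specialization

variable {ι : Type*} [DecidableEq ι]

theorem map_rootProd {σ A B : Type*} [CommRing A] [CommRing B] (φ : A →+* B) (y : σ → A)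
    (e : σ → ℕ) (s : Finset σ) : (rootProd y e s).map φ = rootProd (fun u => φ (y u)) e s := by
  simp [rootProd, Polynomial.map_prod]

theorem map_coeffHom_rootProd {σ A B : Type*} [CommRing A] [Algebra ℂ A] [CommRing B] [Algebra ℂ B]
    (φ : A →ₐ[ℂ] B) (y : σ → A) (e : σ → ℕ) (s : Finset σ) (P : MvPolynomial ℕ ℂ) :
    φ (coeffHom (rootProd y e s) P) = coeffHom (rootProd (fun u => φ (y u)) e s) P := by
  rw [map_coeffHom, map_rootProd]
  rfl

theorem vdeg_coeff_rootProd_le {e : ι → ℕ} {s : Finset ι} {u : ι} (hu : u ∈ s) (he : e u = 1)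
    (l : ℕ) : vdeg u ((rootProd X e s : Polynomial (MvPolynomial ι ℂ)).coeff l) ≤ 1 := by
  rw [vdeg_le_iff]
  intro k hk
  obtain ⟨k, rfl⟩ : ∃ j, k = j + 1 + 1 := ⟨k - 2, by omega⟩
  set c := (rootProd X e s : Polynomial (MvPolynomial ι ℂ)).coeff l
  have h2 : pderiv u (pderiv u c) = 0 := by
    rw [isCoeffPderiv_rootProd e hu l, he, Nat.cast_one, one_mul, Polynomial.coeff_neg, map_neg,
      isCoeffPderiv_rootProd₁ e l, he]
    simp
  have h3 := congrArg (cf u k) h2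
  rw [cf_pderiv_self, cf_pderiv_self, map_zero, smul_smul] at h3
  exact (smul_eq_zero.1 h3).resolve_left
    (mul_ne_zero (Nat.cast_add_one_ne_zero k) (Nat.cast_add_one_ne_zero (k + 1)))

theorem vdeg_coeffHom_le {F : Polynomial (MvPolynomial ι ℂ)} {u : ι}
    (hF : ∀ l, vdeg u (F.coeff l) ≤ 1) {P : MvPolynomial ℕ ℂ} {n : ℕ} (hP : P.IsHomogeneous n) :
    vdeg u (coeffHom F P) ≤ n := by
  have : slice u (coeffHom F P) = aeval (fun l => slice u (F.coeff l)) P := by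
    have : (slice u).comp (coeffHom F) = aeval (fun l => slice u (F.coeff l)) := by
      ext l; simp [coeffHom]
    exact DFunLike.congr_fun this P
  rw [vdeg, this, aeval_def, eval₂_eq]
  refine Polynomial.natDegree_sum_le_of_forall_le _ _ fun d hd => ?_
  rw [← degree_eq_of_coeff_ne_zero hP (mem_support_iff.1 hd),
    IsScalarTower.algebraMap_apply ℂ (MvPolynomial ι ℂ)]
  refine (Polynomial.natDegree_C_mul_le _ _).trans ((Polynomial.natDegree_prod_le _ _).trans ?_)
  rw [Finsupp.degree_apply]
  refine Finset.sum_le_sum fun l _ => Polynomial.natDegree_pow_le.trans ?_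
  exact (Nat.mul_le_mul_left _ (hF l)).trans (by omega)

end Specialization

section Descent

/-- Homogeneous polynomials in the coefficients vanishing on `a`-th powers of forms of degree
`b`. -/
noncomputable def powerIdeal (a b n : ℕ) : Submodule ℂ (MvPolynomial ℕ ℂ) :=
  homogeneousSubmodule ℕ ℂ n ⊓ LinearMap.ker
    (coeffHom (rootProd (X : Fin b → MvPolynomial (Fin b) ℂ) (fun _ => a)
      Finset.univ)).toLinearMap

theorem mem_powerIdeal {a b n : ℕ} {P : MvPolynomial ℕ ℂ} :
    P ∈ powerIdeal a b n ↔ P.IsHomogeneous n ∧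
      coeffHom (rootProd (X : Fin b → MvPolynomial (Fin b) ℂ) (fun _ => a) Finset.univ) P = 0 := by
  simp [powerIdeal]

theorem lowOp_mem_powerIdeal {a b n : ℕ} {P : MvPolynomial ℕ ℂ} (hP : P ∈ powerIdeal a b n) :
    lowOp (a * b + 1) P ∈ powerIdeal a b n := by
  rw [mem_powerIdeal] at *
  refine ⟨isHomogeneous_lowOp hP.1 _, ?_⟩
  rw [← neg_eq_zero, ← fop_coeffHom_rootProd (by simp [mul_comm]), hP.2, map_zero]

theorem secOp_mem_powerIdeal {a b n : ℕ} (ha : 1 ≤ a) {P : MvPolynomial ℕ ℂ}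
    (hP : P ∈ powerIdeal a b n) : secOp a (a * b + 1) P ∈ powerIdeal a b n := by
  rw [mem_powerIdeal] at *
  refine ⟨isHomogeneous_secOp hP.1 _ _, ?_⟩
  have := eRel_coeffHom_rootProd (K := a * b + 1) (s := (Finset.univ : Finset (Fin b))) ha
    (e := fun _ => a) (by simp) (by simp [mul_comm]) P
  rw [hP.2] at this
  exact this.eq_zero

/-- The product of `(x - α) ^ a` over `α ∈ s` and of `x - β` over `β ∈ t`. -/
noncomputable def splitForm {A : Type*} [CommRing A] (a : ℕ) (s t : Multiset A) : Polynomial A :=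
  (s.map fun c => Polynomial.X - Polynomial.C c).prod ^ a *
    (t.map fun c => Polynomial.X - Polynomial.C c).prod

theorem exists_map_univ_eq {A : Type*} (s : Multiset A) :
    ∃ y : Fin s.card → A, s = Finset.univ.val.map y := by
  obtain ⟨l, rfl⟩ : ∃ l : List A, (l : Multiset A) = s := Quot.exists_rep s
  have h : (l : Multiset A) = Finset.univ.val.map l.get := by rw [Fin.univ_val_map, List.ofFn_get]
  exact ⟨l.get, h⟩

/-- The elements of `powerIdeal` vanish on all products of `i` linear forms to the power `a` and
`a * (b - i)` linear forms. -/
def VanishesOnSplit (a b n i : ℕ) : Prop :=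
  ∀ P ∈ powerIdeal a b n, ∀ (A : Type) [CommRing A] [Algebra ℂ A] (s t : Multiset A),
    s.card = i → t.card = a * (b - i) → coeffHom (splitForm a s t) P = 0

theorem vanishesOnSplit_self (a b n : ℕ) : VanishesOnSplit a b n b := by
  intro P hP A _ _ s t hs ht
  subst hs
  obtain ⟨y, hy⟩ := exists_map_univ_eq s
  rw [Nat.sub_self, mul_zero, Multiset.card_eq_zero] at ht
  have h := congrArg (aeval y) (mem_powerIdeal.1 hP).2
  rw [map_coeffHom_rootProd, map_zero] at h
  rw [← h, ht]
  congr 2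
  conv_lhs => rw [hy]
  rw [splitForm, Multiset.map_map, Multiset.map_zero, Multiset.prod_zero, mul_one, rootProd,
    Finset.prod_pow]
  simp only [aeval_X]
  rfl

theorem rootProd_eq_splitForm {ι A : Type*} [DecidableEq ι] [CommRing A] {a : ℕ} (y : ι → A)
    {e : ι → ℕ} {s : Finset ι} (he : ∀ u ∈ s, e u = 1 ∨ e u = a) :
    rootProd y e s =
      splitForm a ((s.filter (e · ≠ 1)).val.map y) ((s.filter (e · = 1)).val.map y) := by
  rw [rootProd, ← Finset.prod_filter_not_mul_prod_filter s (e · = 1), splitForm]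
  congr 1
  · rw [Multiset.map_map, Multiset.prod_map_pow.symm]
    refine Finset.prod_congr rfl fun u hu => ?_
    obtain ⟨hu, h1⟩ := Finset.mem_filter.1 hu
    rw [(he u hu).resolve_left h1]
    rfl
  · rw [Multiset.map_map]
    refine Finset.prod_congr rfl fun u hu => ?_
    rw [(Finset.mem_filter.1 hu).2, pow_one]
    rfl

theorem splitForm_cons {A : Type*} [CommRing A] (a : ℕ) (s t : Multiset A) (c : A) :
    splitForm a (c ::ₘ s) t = splitForm a s (Multiset.replicate a c + t) := by
  simp [splitForm, mul_pow]
  ring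

theorem rootProd_sum_eq_splitForm {A : Type*} [CommRing A] (a : ℕ) {i j : ℕ} (y : Fin i → A)
    (z : Fin j → A) :
    rootProd (Sum.elim y z) (Sum.elim (fun _ => a) fun _ => 1) Finset.univ =
      splitForm a (Finset.univ.val.map y) (Finset.univ.val.map z) := by
  rw [rootProd, Fintype.prod_sum_type, splitForm, Multiset.map_map, Multiset.map_map]
  simp only [Sum.elim_inl, Sum.elim_inr, pow_one, Finset.prod_pow]
  rfl

/-- The evaluations of the elements of `powerIdeal` form a stable space. -/
theorem stable_map_powerIdeal {a b n i : ℕ} (ha : 2 ≤ a) (hi : i < b)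
    (h : VanishesOnSplit a b n (i + 1)) {ι : Type} [Fintype ι] [DecidableEq ι] {e : ι → ℕ}
    (he : ∀ u, e u = 1 ∨ e u = a) (h1 : (Finset.univ.filter (e · = 1)).card = a * (b - i))
    (h2 : (Finset.univ.filter (e · ≠ 1)).card = i) :
    Stable a e Finset.univ ((powerIdeal a b n).map
      (coeffHom (rootProd (X : ι → MvPolynomial ι ℂ) e Finset.univ)).toLinearMap) := by
  have he' : ∀ u ∈ (Finset.univ : Finset ι), e u = 1 ∨ e u = a := fun u _ => he u
  have hK : ∑ u, e u < a * b + 1 := by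
    rw [sum_weights_eq he', h1, h2, ← mul_add]
    exact Nat.lt_succ_of_le (Nat.mul_le_mul_left a (by omega))
  constructor
  · intro T _ s _ v hv
    exact absurd (Finset.mem_univ v) hv
  · rintro _ ⟨P, hP, rfl⟩ u _ v _ huv
    simp only [AlgHom.toLinearMap_apply]
    rw [map_coeffHom_rootProd]
    congr 2
    simp only [rename_X, rootProd]
    refine Fintype.prod_equiv (Equiv.swap u v) _ _ fun w => ?_
    congr 1
    rw [Equiv.swap_apply_def]
    split_ifs with hw hw' <;> simp_all
  · rintro _ ⟨P, hP, rfl⟩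
    refine ⟨-lowOp (a * b + 1) P, neg_mem (lowOp_mem_powerIdeal hP), ?_⟩
    simp only [AlgHom.toLinearMap_apply]
    rw [map_neg, ← fop_coeffHom_rootProd hK]
  · rintro _ ⟨P, hP, rfl⟩
    exact ⟨_, ⟨_, secOp_mem_powerIdeal (by omega) hP, rfl⟩,
      eRel_coeffHom_rootProd (by omega) he' hK P⟩
  · rintro S - hS1 hSa c hc _ ⟨P, hP, rfl⟩
    simp only [AlgHom.toLinearMap_apply]
    rw [map_coeffHom_rootProd, rootProd_eq_splitForm _ he']
    simp only [rename_X]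
    set m : ι → MvPolynomial ι ℂ := fun u => X (if u ∈ S then c else u)
    have hSf : S ⊆ Finset.univ.filter (e · = 1) := fun v hv =>
      Finset.mem_filter.2 ⟨Finset.mem_univ _, hS1 v hv⟩
    have hval : (Finset.univ.filter (e · = 1)).val.map m =
        Multiset.replicate a (X c) + (Finset.univ.filter (e · = 1) \ S).val.map m := by
      rw [Finset.sdiff_val, ← Multiset.map_id (Multiset.replicate a (X c)),
        ← add_tsub_cancel_of_le (Finset.val_le_iff.2 hSf), Multiset.map_add, Multiset.map_id]
      congr 1
      · rw [← hSa, ← Finset.card_val]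
        refine Multiset.eq_replicate.2 ⟨by simp, fun x hx => ?_⟩
        obtain ⟨v, hv, rfl⟩ := Multiset.mem_map.1 hx
        exact congrArg X (if_pos hv)
      · rw [add_tsub_cancel_of_le (Finset.val_le_iff.2 hSf)]
    rw [hval, ← splitForm_cons]
    refine h P hP _ _ _ (by rw [Multiset.card_cons, Multiset.card_map, Finset.card_val, h2]) ?_
    rw [Multiset.card_map, Finset.card_val, Finset.card_sdiff_of_subset hSf, h1, hSa,
      ← Nat.mul_sub_one, Nat.sub_sub]

theorem VanishesOnSplit.descend {a b n i : ℕ} (ha : 2 ≤ a) (hn : n ≤ b) (hi : i < b)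
    (h : VanishesOnSplit a b n (i + 1)) : VanishesOnSplit a b n i := by
  intro P hP A _ _ s t hs ht
  obtain ⟨y, hy⟩ := exists_map_univ_eq s
  obtain ⟨z, hz⟩ := exists_map_univ_eq t
  rw [hy, hz, ← rootProd_sum_eq_splitForm]
  set e : Fin s.card ⊕ Fin t.card → ℕ := Sum.elim (fun _ => a) fun _ => 1 with he_def
  have ha1 : a ≠ 1 := by omega
  have he : ∀ u, e u = 1 ∨ e u = a := by rintro (u | u) <;> simp [he_def]
  have h1 : (Finset.univ.filter (e · = 1)).card = a * (b - i) := by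
    rw [Finset.card_filter, Fintype.sum_sum_type]
    simp [he_def, ha1, ht]
  have h2 : (Finset.univ.filter (e · ≠ 1)).card = i := by
    rw [Finset.card_filter, Fintype.sum_sum_type]
    simp [he_def, ha1, hs]
  have hpos : 0 < t.card := ht ▸ Nat.mul_pos (by omega) (by omega)
  suffices h0 : coeffHom (rootProd (X : _ → MvPolynomial _ ℂ) e Finset.univ) P = 0 by
    have := congrArg (aeval (Sum.elim y z)) h0
    rw [map_coeffHom_rootProd, map_zero] at this
    simpa only [aeval_X] using this
  by_contra hne
  obtain ⟨ρ, hρ⟩ : ∃ ρ, e ρ = 1 := ⟨Sum.inr ⟨0, hpos⟩, by simp [he_def]⟩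
  have hge := (stable_map_powerIdeal ha hi h he h1 h2).vdeg_ge ha (fun u _ => he u)
    (by rw [h1]; exact Nat.le_mul_of_pos_right a (by omega)) (Finset.mem_univ ρ) hρ
    (Submodule.mem_map_of_mem hP) hne
  have hle := vdeg_coeffHom_le
    (vdeg_coeff_rootProd_le (e := e) (Finset.mem_univ ρ) hρ) (mem_powerIdeal.1 hP).1
  rw [h1, h2, Nat.mul_div_cancel_left _ (by omega)] at hge
  simp only [AlgHom.toLinearMap_apply] at hge
  omega

theorem vanishesOnSplit {a b n : ℕ} (ha : 2 ≤ a) (hn : n ≤ b) : VanishesOnSplit a b n 0 := by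
  have : ∀ k ≤ b, VanishesOnSplit a b n (b - k) := by
    intro k
    induction k with
    | zero => exact fun _ => vanishesOnSplit_self a b n
    | succ k ih =>
      intro hk
      refine VanishesOnSplit.descend ha hn (by omega) ?_
      rw [(by omega : b - (k + 1) + 1 = b - k)]
      exact ih (by omega)
  have := this b le_rfl
  rwa [Nat.sub_self] at this

end Descent

section FoulkesHowe

theorem isHomogeneous_genForm (b : ℕ) : (genForm b).IsHomogeneous b := by
  refine IsHomogeneous.sum _ _ _ fun i _ => ?_
  have := ((isHomogeneous_C (Fin 2) (X i : MvPolynomial (Fin (b + 1)) ℂ)).mul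
    ((isHomogeneous_X _ (0 : Fin 2)).pow (i : ℕ))).mul
    ((isHomogeneous_X _ (1 : Fin 2)).pow (b - (i : ℕ)))
  convert this using 1
  omega

/-- Setting `y = 1` in a binary form does not change its coefficients. -/
theorem coeff_dehomogenize {R A : Type*} [CommRing R] [CommRing A] (φ : R →+* A)
    {H : MvPolynomial (Fin 2) R} {d : ℕ} (hH : H.IsHomogeneous d) (j : ℕ) :
    (eval₂ (Polynomial.C.comp φ) ![Polynomial.X, 1] H).coeff j =
      φ (coeff (Finsupp.single 0 j + Finsupp.single 1 (d - j)) H) := by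
  have hterm : ∀ s ∈ H.support, ((Polynomial.C.comp φ) (coeff s H) *
      ∏ i, (![Polynomial.X, 1] : Fin 2 → Polynomial A) i ^ s i).coeff j =
      if s = Finsupp.single 0 j + Finsupp.single 1 (d - j) then φ (coeff s H) else 0 := by
    intro s hs
    have hdeg : s 0 + s 1 = d := by
      have : s.degree = d := by
        by_contra h
        exact mem_support_iff.1 hs (hH.coeff_eq_zero h)
      rwa [Finsupp.degree_eq_sum, Fin.sum_univ_two] at this
    have hiff : s = Finsupp.single 0 j + Finsupp.single 1 (d - j) ↔ j = s 0 := by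
      constructor
      · intro h; rw [h]; simp
      · intro h
        ext i
        fin_cases i
        · simp [h]
        · simp; omega
    rw [if_congr hiff rfl rfl]
    simp [Fin.prod_univ_two, Polynomial.coeff_X_pow]
  rw [eval₂_eq', Polynomial.finsetSum_coeff, Finset.sum_congr rfl hterm, Finset.sum_ite_eq']
  split_ifs with h
  · rfl
  · rw [notMem_support_iff.1 h, map_zero]

theorem aeval_coeffC {A : Type*} [CommRing A] [Algebra ℂ A] (a : ℕ) {b : ℕ} (j : ℕ)
    {p : Polynomial A} (hp : p.natDegree ≤ b) :
    aeval (fun i : Fin (b + 1) => p.coeff i) (coeffC a b j) = (p ^ a).coeff j := by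
  set φ : MvPolynomial (Fin (b + 1)) ℂ →ₐ[ℂ] A := aeval fun i : Fin (b + 1) => p.coeff i
  have hH : (genForm b ^ a).IsHomogeneous (a * b) := by
    rw [mul_comm]
    exact (isHomogeneous_genForm b).pow a
  have := coeff_dehomogenize φ.toRingHom hH j
  rw [coeffC]
  refine Eq.trans this.symm ?_
  rw [eval₂_pow]
  congr 2
  rw [genForm, eval₂_sum]
  conv_rhs => rw [p.as_sum_range' (b + 1) (by omega), ← Fin.sum_univ_eq_sum_range
    (fun i => Polynomial.monomial i (p.coeff i))]
  refine Finset.sum_congr rfl fun i _ => ?_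
  simp [φ, Polynomial.C_mul_X_pow_eq_monomial]

theorem rename_mem_powerIdeal {a b n : ℕ} {P : MvPolynomial (Fin (a * b + 1)) ℂ}
    (hP : P.IsHomogeneous n) (h : FH a b P = 0) :
    rename Fin.val P ∈ powerIdeal a b n := by
  refine mem_powerIdeal.2 ⟨hP.rename_isHomogeneous, ?_⟩
  set p : Polynomial (MvPolynomial (Fin b) ℂ) := rootProd X (fun _ => 1) Finset.univ with hp_def
  have hp : p.natDegree ≤ b := by
    simpa using natDegree_rootProd_le (s := Finset.univ) (X : Fin b → MvPolynomial (Fin b) ℂ)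
      (fun _ => 1)
  have hpa : rootProd (X : Fin b → MvPolynomial (Fin b) ℂ) (fun _ => a) Finset.univ = p ^ a := by
    simp [hp_def, rootProd, Finset.prod_pow]
  have := congrArg (aeval fun i : Fin (b + 1) => p.coeff i) h
  rw [FH, map_zero, ← AlgHom.comp_apply, comp_aeval] at this
  rw [hpa, coeffHom, aeval_rename, ← this]
  congr 2
  funext j
  exact (aeval_coeffC a j hp).symm

theorem eval_mul_of_isHomogeneous {σ : Type*} [Fintype σ] [DecidableEq σ]
    {P : MvPolynomial σ ℂ} {n : ℕ}
    (hP : P.IsHomogeneous n) (c : ℂ) (z : σ → ℂ) :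
    eval (fun i => c * z i) P = c ^ n * eval z P := by
  rw [eval_eq', eval_eq', Finset.mul_sum]
  refine Finset.sum_congr rfl fun d hd => ?_
  have := degree_eq_of_coeff_ne_zero hP (mem_support_iff.1 hd)
  rw [Finsupp.degree_eq_sum] at this
  simp_rw [mul_pow]
  rw [Finset.prod_mul_distrib, Finset.prod_pow_eq_pow_sum, this]
  ring

theorem eq_zero_of_vanishesOnSplit {a b n : ℕ} (h : VanishesOnSplit a b n 0)
    {P : MvPolynomial (Fin (a * b + 1)) ℂ} (hP : P.IsHomogeneous n)
    (hmem : rename Fin.val P ∈ powerIdeal a b n) : P = 0 := by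
  suffices hX : X (Fin.last (a * b)) * P = 0 from (mul_eq_zero.1 hX).resolve_left (X_ne_zero _)
  refine MvPolynomial.funext fun z => ?_
  rw [map_mul, eval_X, map_zero, mul_eq_zero, or_iff_not_imp_left]
  intro hz
  set w : Fin (a * b + 1) → ℂ := fun i => (z (Fin.last (a * b)))⁻¹ * z i with hw
  set q : Polynomial ℂ := ∑ i : Fin (a * b + 1), Polynomial.monomial (i : ℕ) (w i) with hq
  have hcoeff : ∀ i : Fin (a * b + 1), q.coeff i = w i := by
    intro i
    simp [hq, Polynomial.coeff_monomial, Fin.val_inj]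
  have hdeg : q.natDegree ≤ a * b := by
    refine Polynomial.natDegree_sum_le_of_forall_le _ _ fun i _ => ?_
    exact (Polynomial.natDegree_monomial_le _).trans (Nat.lt_succ_iff.1 i.2)
  have hlast : q.coeff (a * b) = 1 := by
    rw [← Fin.val_last (a * b), hcoeff, hw]
    exact inv_mul_cancel₀ hz
  have hmonic : q.Monic := Polynomial.monic_of_natDegree_le_of_coeff_eq_one (a * b) hdeg hlast
  have hN : q.natDegree = a * b := le_antisymm hdeg
    (Polynomial.le_natDegree_of_ne_zero (by rw [hlast]; exact one_ne_zero))
  have hsplit := IsAlgClosed.splits q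
  have hval := h _ hmem ℂ 0 q.roots rfl
    (by rw [← hsplit.natDegree_eq_card_roots, hN, Nat.sub_zero])
  rw [splitForm, Multiset.map_zero, Multiset.prod_zero, one_pow, one_mul,
    ← hsplit.eq_prod_roots_of_monic hmonic, coeffHom, aeval_rename] at hval
  have hw0 : eval w P = 0 := by
    rw [← hval, show q.coeff ∘ Fin.val = w from _root_.funext hcoeff, aeval_eq_eval]
  rw [hw, eval_mul_of_isHomogeneous hP] at hw0
  exact (mul_eq_zero.1 hw0).resolve_left (pow_ne_zero _ (inv_ne_zero hz))

theorem FH_eq_zero_iff {a b n : ℕ} (ha : 2 ≤ a) (hn : n ≤ b)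
    {P : MvPolynomial (Fin (a * b + 1)) ℂ} (hP : P.IsHomogeneous n) : FH a b P = 0 ↔ P = 0 :=
  ⟨fun h => eq_zero_of_vanishesOnSplit (vanishesOnSplit ha hn) hP (rename_mem_powerIdeal hP h),
    fun h => by rw [h, map_zero]⟩

end FoulkesHowe

section Dimensions

theorem finrank_homogeneousSubmodule (m n : ℕ) :
    Module.finrank ℂ (homogeneousSubmodule (Fin m) ℂ n) = (m + n - 1).choose n := by
  rw [homogeneousSubmodule_eq_finsupp_supported,
    (AddMonoidAlgebra.supportedEquivFinsupp _).finrank_eq]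
  have e : {d : Fin m →₀ ℕ | d.degree = n} ≃ Sym (Fin m) n :=
    (Equiv.subtypeEquivRight fun d => Iff.rfl).trans (Sym.equivNatSum (Fin m) n).symm
  have : Fintype {d : Fin m →₀ ℕ | d.degree = n} := Fintype.ofEquiv _ e.symm
  rw [Module.finrank_finsupp_self, Fintype.card_congr e, Sym.card_sym_eq_choose, Fintype.card_fin]

theorem finrank_map_FH {a b n : ℕ} (ha : 2 ≤ a) (hn : n ≤ b) :
    Module.finrank ℂ ((homogeneousSubmodule (Fin (a * b + 1)) ℂ n).map (FH a b).toLinearMap) =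
      (a * b + n).choose n := by
  rw [← LinearMap.range_domRestrict, LinearMap.finrank_range_of_inj,
    finrank_homogeneousSubmodule]
  · congr 1
    omega
  · rw [← LinearMap.ker_eq_bot, LinearMap.ker_eq_bot']
    rintro ⟨P, hP⟩ h
    exact Subtype.ext ((FH_eq_zero_iff ha hn hP).1 h)

theorem choose_mul_lt_of_le {a c k : ℕ} (hc : 1 ≤ c) (hk : k + 1 < a)
    (h : (a * c + (k + 1) + c).choose c * (a * c + (k + 1)) ≤
      (k + 1) * ((c + 1) * (a * c + (c + 1)).choose (c + 1))) :
    (a * c + (k + 2) + c).choose c * (a * c + (k + 2)) <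
      (k + 2) * ((c + 1) * (a * c + (c + 1)).choose (c + 1)) := by
  have h1 := Nat.choose_mul_succ_eq (a * c + (k + 1) + c) c
  rw [(by omega : a * c + (k + 1) + c + 1 - c = a * c + (k + 2)),
    (by omega : a * c + (k + 1) + c + 1 = a * c + (k + 2) + c)] at h1
  rw [← h1]
  have hD : 0 < (c + 1) * (a * c + (c + 1)).choose (c + 1) :=
    Nat.mul_pos (by omega) (Nat.choose_pos (by omega))
  have h2 : (k + 1) * c < a * c := Nat.mul_lt_mul_of_pos_right hk hc
  have h3 : (k + 1) * (a * c + (k + 2) + c) < (k + 2) * (a * c + (k + 1)) := by nlinarith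
  generalize (c + 1) * (a * c + (c + 1)).choose (c + 1) = D at *
  generalize (a * c + (k + 1) + c).choose c = f at *
  refine lt_of_mul_lt_mul_right (a := a * c + (k + 1)) ?_ (Nat.zero_le _)
  calc f * (a * c + (k + 2) + c) * (a * c + (k + 1))
      = f * (a * c + (k + 1)) * (a * c + (k + 2) + c) := by ring
    _ ≤ (k + 1) * D * (a * c + (k + 2) + c) := Nat.mul_le_mul_right _ h
    _ = (k + 1) * (a * c + (k + 2) + c) * D := by ring
    _ < (k + 2) * (a * c + (k + 1)) * D := Nat.mul_lt_mul_of_pos_right h3 hD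
    _ = (k + 2) * D * (a * c + (k + 1)) := by ring

theorem choose_mul_le {a c : ℕ} (hc : 1 ≤ c) (k : ℕ) (hk : k < a) :
    (a * c + (k + 1) + c).choose c * (a * c + (k + 1)) ≤
      (k + 1) * ((c + 1) * (a * c + (c + 1)).choose (c + 1)) := by
  induction k with
  | zero =>
    have := Nat.choose_succ_right_eq (a * c + (c + 1)) c
    rw [(by omega : a * c + (c + 1) - c = a * c + 1)] at this
    rw [(by omega : a * c + (0 + 1) + c = a * c + (c + 1))]
    simp only [zero_add]
    rw [← this]
    exact le_of_eq (by ring)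
  | succ k ih => exact (choose_mul_lt_of_le hc hk (ih (by omega))).le

theorem choose_lt_choose {a b : ℕ} (ha : 2 ≤ a) (hb : 2 ≤ b) :
    (a * b + b - 1).choose (b - 1) < (a * b - a + b).choose b := by
  obtain ⟨c, rfl⟩ : ∃ c, b = c + 1 := ⟨b - 1, by omega⟩
  obtain ⟨k, rfl⟩ : ∃ k, a = k + 2 := ⟨a - 2, by omega⟩
  have hc : 1 ≤ c := by omega
  have := choose_mul_lt_of_le (a := k + 2) hc (k := k) (by omega)
    (choose_mul_le hc k (by omega))
  have h1 : (k + 2) * (c + 1) = (k + 2) * c + (k + 2) := by ring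
  rw [(by omega : (k + 2) * (c + 1) + (c + 1) - 1 = (k + 2) * c + (k + 2) + c),
    (by omega : (k + 2) * (c + 1) - (k + 2) + (c + 1) = (k + 2) * c + (c + 1)),
    Nat.add_sub_cancel]
  refine lt_of_mul_lt_mul_right (a := (k + 2) * (c + 1)) ?_ (Nat.zero_le _)
  calc _ = ((k + 2) * c + (k + 2) + c).choose c * ((k + 2) * c + (k + 2)) := by rw [h1]
    _ < _ := this
    _ = _ := by ring

end Dimensions

/-- For `a, b ≥ 2`, the Foulkes–Howe map is not surjective in degree `b-1`; the
codimension of the image of the degree-`(b-1)` component of `S` inside the space of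
homogeneous polynomials of degree `a(b-1)` in `R` equals `C(d−a+b, b) − C(d+b−1, b−1)`
(with `d = ab`), and in particular `C(ab−a+b, b) > C(ab+b−1, b−1)`. -/
theorem foulkesHowe_not_surjective_degree_b_sub_one (a b : ℕ) (ha : 2 ≤ a) (hb : 2 ≤ b) :
    (∃ Q : MvPolynomial (Fin (b + 1)) ℂ, Q.IsHomogeneous (a * (b - 1)) ∧
      ∀ P : MvPolynomial (Fin (a * b + 1)) ℂ, P.IsHomogeneous (b - 1) → FH a b P ≠ Q) ∧
    ((Module.finrank ℂ
        ↥(MvPolynomial.homogeneousSubmodule (Fin (b + 1)) ℂ (a * (b - 1))) : ℤ) -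
      (Module.finrank ℂ
        ↥((MvPolynomial.homogeneousSubmodule (Fin (a * b + 1)) ℂ (b - 1)).map
            (FH a b).toLinearMap) : ℤ) =
      ((a * b - a + b).choose b : ℤ) - ((a * b + b - 1).choose (b - 1) : ℤ)) ∧
    (a * b + b - 1).choose (b - 1) < (a * b - a + b).choose b := by
  have hsource : Module.finrank ℂ
      ((homogeneousSubmodule (Fin (a * b + 1)) ℂ (b - 1)).map (FH a b).toLinearMap) =
      (a * b + b - 1).choose (b - 1) := by
    rw [finrank_map_FH ha (Nat.sub_le b 1), Nat.add_sub_assoc (by omega)]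
  have htarget : Module.finrank ℂ (homogeneousSubmodule (Fin (b + 1)) ℂ (a * (b - 1))) =
      (a * b - a + b).choose b := by
    rw [finrank_homogeneousSubmodule, Nat.mul_sub_one,
      (by omega : b + 1 + (a * b - a) - 1 = a * b - a + b), Nat.choose_symm_add]
  refine ⟨?_, by rw [hsource, htarget], choose_lt_choose ha hb⟩
  by_contra! hsurj
  have hle : homogeneousSubmodule (Fin (b + 1)) ℂ (a * (b - 1)) ≤
      (homogeneousSubmodule (Fin (a * b + 1)) ℂ (b - 1)).map (FH a b).toLinearMap := by
    intro Q hQ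
    obtain ⟨P, hP, hPQ⟩ := hsurj Q hQ
    exact ⟨P, hP, hPQ⟩
  have hfin : Module.Finite ℂ
      ((homogeneousSubmodule (Fin (a * b + 1)) ℂ (b - 1)).map (FH a b).toLinearMap) :=
    Module.Finite.iff_fg.2 ((homogeneousSubmodule_fg _ _ _).map _)
  have := Submodule.finrank_mono hle
  rw [hsource, htarget] at this
  exact absurd (choose_lt_choose ha hb) this.not_gt
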